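/- arXiv:1411.3366 — 3 statements merged into one kernel-verified Lean document; each statement's English description precedes it below -/
import Mathlib

section
/- For a Banach space X the following are equivalent: (1) X is not superreflexive; (2) there exists α ∈ (0,1] such that for each m ∈ ℕ there are vectors x₁,…,x_m in the closed unit ball of X satisfying, for every j ∈ {1,…,m−1} and all real coefficients a₁,…,a_m, the inequality ‖Σ_{i=1}^m a_i x_i‖ ≥ α·(|Σ_{i=1}^j a_i| + |Σ_{i=j+1}^m a_i|); (3) for every α ∈ (0,1) and every m ∈ ℕ there are vectors x₁,…,x_m in the closed unit ball of X satisfying the same inequality. -/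
noncomputable section

/-- `X` is finitely representable in `Y`. -/
def FinitelyRepresentable (X Y : Type) [NormedAddCommGroup X] [NormedSpace ℝ X]
    [NormedAddCommGroup Y] [NormedSpace ℝ Y] : Prop :=
  ∀ ε : ℝ, 0 < ε → ∀ F : Submodule ℝ X, FiniteDimensional ℝ F →
    ∃ G : Submodule ℝ Y, FiniteDimensional ℝ G ∧
      ∃ T : F ≃L[ℝ] G, ‖(T : F →L[ℝ] G)‖ * ‖(T.symm : G →L[ℝ] F)‖ ≤ 1 + ε

/-- A Banach space is reflexive if the canonical embedding into the double dual is
surjective. -/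
def IsReflexiveBanach (X : Type) [NormedAddCommGroup X] [NormedSpace ℝ X] : Prop :=
  Function.Surjective (NormedSpace.inclusionInDoubleDual ℝ X)

/-- `Y` is superreflexive: every Banach space finitely representable in `Y` is reflexive. -/
def SuperReflexive (Y : Type) [NormedAddCommGroup Y] [NormedSpace ℝ Y] : Prop :=
  ∀ (X : Type) [NormedAddCommGroup X] [NormedSpace ℝ X] [CompleteSpace X],
    FinitelyRepresentable X Y → IsReflexiveBanach X

/-- There are vectors `x₀, …, x_{m-1}` in the closed unit ball of `X` such that for every
`j ∈ {1,…,m−1}` and all real coefficients, `‖∑ aᵢ xᵢ‖ ≥ α (|∑_{i<j} aᵢ| + |∑_{j≤i<m} aᵢ|)`. -/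
def FlatSequence (X : Type) [NormedAddCommGroup X] [NormedSpace ℝ X] (α : ℝ) (m : ℕ) : Prop :=
  ∃ x : ℕ → X, (∀ i < m, ‖x i‖ ≤ 1) ∧
    ∀ j : ℕ, 1 ≤ j → j ≤ m - 1 → ∀ a : ℕ → ℝ,
      α * (|∑ i ∈ Finset.range j, a i| + |∑ i ∈ Finset.Ico j m, a i|) ≤
        ‖∑ i ∈ Finset.range m, a i • x i‖

/-- Helly's theorem: an element of the bidual agrees on finitely many functionals with a vector of
almost the same norm. -/
theorem exists_norm_lt_forall_apply_eq {E : Type*} [NormedAddCommGroup E] [NormedSpace ℝ E]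
    {ι : Type*} [Finite ι] (φ : StrongDual ℝ (StrongDual ℝ E)) (f : ι → StrongDual ℝ E)
    {M : ℝ} (hM : ‖φ‖ < M) : ∃ x : E, ‖x‖ < M ∧ ∀ i, f i x = φ (f i) := by
  have := Fintype.ofFinite ι
  let T : E →L[ℝ] (ι → ℝ) := ContinuousLinearMap.pi f
  have key (g : (ι → ℝ) →ₗ[ℝ] ℝ) : ∃ h : StrongDual ℝ E,
      (∀ x, h x = g (T x)) ∧ φ h = g fun i ↦ φ (f i) := by
    classical
    refine ⟨∑ i, g (fun j ↦ if i = j then 1 else 0) • f i, fun x ↦ ?_, ?_⟩ <;>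
    · rw [LinearMap.pi_apply_eq_sum_univ g]
      simp [T, mul_comm]
  let R : Submodule ℝ (ι → ℝ) := LinearMap.range T.toLinearMap
  have hv : (fun i ↦ φ (f i)) ∈ R := by
    by_contra hv
    obtain ⟨g, hgv, hg⟩ := Submodule.exists_le_ker_of_notMem hv
    obtain ⟨h, hh, hφ⟩ := key g
    have : h = 0 := by
      ext x
      rw [hh]
      exact hg ⟨x, rfl⟩
    exact hgv (by rw [← hφ, this, map_zero])
  let T' : E →ₗ[ℝ] R := T.toLinearMap.rangeRestrict
  have hopen : IsOpen (T' '' Metric.ball 0 M) :=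
    T'.isOpenMap_of_finiteDimensional T.toLinearMap.surjective_rangeRestrict _ Metric.isOpen_ball
  have hconv : Convex ℝ (T' '' Metric.ball 0 M) := (convex_ball 0 M).linear_image T'
  by_cases hmem : (⟨_, hv⟩ : R) ∈ T' '' Metric.ball 0 M
  · obtain ⟨x, hx, hTx⟩ := hmem
    exact ⟨x, by simpa using hx, fun i ↦ congrFun (congrArg Subtype.val hTx) i⟩
  · exfalso
    obtain ⟨g, hg⟩ := geometric_hahn_banach_open_point hconv hopen hmem
    obtain ⟨g', hg'⟩ := LinearMap.exists_extend g.toLinearMap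
    obtain ⟨h, hh, hφ⟩ := key g'
    have hg'' (r : R) : g' r = g r := LinearMap.congr_fun hg' r
    have hlt (x : E) (hx : ‖x‖ < M) : h x < φ h := by
      rw [hh, hφ]
      have := hg (T' x) ⟨x, by simpa using hx, rfl⟩
      rwa [← hg'', ← hg''] at this
    obtain ⟨c, hc, hcM⟩ := exists_between hM
    have hc0 : 0 < c := (norm_nonneg φ).trans_lt hc
    have hpos : 0 < φ h := by simpa using hlt 0 (by simpa using hc0.trans hcM)
    have hle : ‖h‖ ≤ φ h / c := by
      refine ContinuousLinearMap.opNorm_bound_of_ball_bound hc0 _ h fun x hx ↦ ?_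
      have hx : ‖x‖ < M := (mem_closedBall_zero_iff.1 hx).trans_lt hcM
      have := hlt (-x) (by rwa [norm_neg])
      rw [map_neg] at this
      exact abs_le.2 ⟨by linarith, (hlt x hx).le⟩
    have h1 : φ h ≤ ‖φ‖ * ‖h‖ := (le_abs_self _).trans (φ.le_opNorm h)
    have h2 : ‖φ‖ * ‖h‖ ≤ ‖φ‖ * (φ h / c) := by gcongr
    have h3 : ‖φ‖ * (φ h / c) < φ h := by
      rw [← mul_div_assoc, div_lt_iff₀ hc0, mul_comm]
      gcongr
    linarith

/-- A functional at positive distance from the range of an isometry into a dual space can be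
separated from finitely many points of this range by vectors of bounded norm. -/
theorem exists_bound_forall_exists_apply_eq_one {Z F : Type*} [NormedAddCommGroup Z]
    [NormedSpace ℝ Z] [CompleteSpace Z] [NormedAddCommGroup F] [NormedSpace ℝ F]
    (J : Z →ₗᵢ[ℝ] StrongDual ℝ F) (φ : StrongDual ℝ F) (hφ : ∀ z, J z ≠ φ) :
    ∃ D : ℝ, ∀ (ι : Type) [Finite ι] (z : ι → Z),
      ∃ ξ : F, ‖ξ‖ ≤ D ∧ φ ξ = 1 ∧ ∀ i, J (z i) ξ = 0 := by
  have hclosed : IsClosed (Set.range J) := J.isometry.isClosedEmbedding.isClosed_range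
  have hconv : Convex ℝ (Set.range J) := (LinearMap.range J.toLinearMap).convex
  obtain ⟨Ψ, u, hu, hJ⟩ := geometric_hahn_banach_point_closed (x := φ) hconv hclosed
    (by rintro ⟨z, hz⟩; exact hφ z hz)
  have hu0 : u < 0 := by simpa using hJ (J 0) ⟨0, rfl⟩
  have hΨφ : Ψ φ ≠ 0 := (hu.trans hu0).ne
  have hΨJ (z : Z) : Ψ (J z) = 0 := by
    by_contra h
    have := hJ (J ((u / Ψ (J z)) • z)) ⟨_, rfl⟩
    rw [map_smul, map_smul, smul_eq_mul, div_mul_cancel₀ _ h] at this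
    exact lt_irrefl _ this
  refine ⟨‖(Ψ φ)⁻¹ • Ψ‖ + 1, fun ι _ z ↦ ?_⟩
  obtain ⟨ξ, hξ, hz⟩ := exists_norm_lt_forall_apply_eq ((Ψ φ)⁻¹ • Ψ)
    (fun o : Option ι ↦ o.elim φ fun i ↦ J (z i)) (lt_add_one _)
  refine ⟨ξ, hξ.le, (hz none).trans ?_, fun i ↦ (hz (some i)).trans ?_⟩
  · simp [hΨφ]
  · simp [hΨJ]

/-- In a nonreflexive Banach space there is a bounded system of vectors and functionals such that
the `n`-th functional takes the value `1` on all vectors after the `n`-th one and `0` on the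
others. -/
theorem exists_triangular_system {Z : Type} [NormedAddCommGroup Z] [NormedSpace ℝ Z]
    [CompleteSpace Z] (hZ : ¬ IsReflexiveBanach Z) :
    ∃ (C D : ℝ) (x : ℕ → Z) (ξ : ℕ → StrongDual ℝ Z), (∀ n, ‖x n‖ ≤ C) ∧ (∀ n, ‖ξ n‖ ≤ D) ∧
      ∀ n k, ξ n (x k) = if n < k then 1 else 0 := by
  obtain ⟨φ, hφ⟩ : ∃ φ, ∀ z, NormedSpace.inclusionInDoubleDual ℝ Z z ≠ φ := by
    simpa [IsReflexiveBanach, Function.Surjective] using hZ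
  obtain ⟨D, hD⟩ := exists_bound_forall_exists_apply_eq_one
    (NormedSpace.inclusionInDoubleDualLi ℝ (E := Z)) φ hφ
  obtain ⟨f, hP, hr⟩ := exists_seq_of_forall_finset_exists
    (fun p : Z × StrongDual ℝ Z ↦ ‖p.1‖ ≤ ‖φ‖ + 1 ∧ ‖p.2‖ ≤ D ∧ φ p.2 = 1 ∧ p.2 p.1 = 0)
    (fun p q ↦ p.2 q.1 = 1 ∧ q.2 p.1 = 0) fun s hs ↦ by
      obtain ⟨x, hx, hsx⟩ := exists_norm_lt_forall_apply_eq φ (fun p : s ↦ p.1.2) (lt_add_one ‖φ‖)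
      obtain ⟨ξ, hξ, hφξ, hsξ⟩ := hD (Option s) fun o ↦ o.elim x fun p ↦ p.1.1
      exact ⟨(x, ξ), ⟨hx.le, hξ, hφξ, hsξ none⟩,
        fun p hp ↦ ⟨(hsx ⟨p, hp⟩).trans (hs p hp).2.2.1, hsξ (some ⟨p, hp⟩)⟩⟩
  refine ⟨_, _, fun n ↦ (f n).1, fun n ↦ (f n).2, fun n ↦ (hP n).1, fun n ↦ (hP n).2.1,
    fun n k ↦ ?_⟩
  split_ifs with h
  · exact (hr n k h).1
  · rcases (not_lt.1 h).eq_or_lt with rfl | h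
    · exact (hP k).2.2.2
    · exact (hr k n h).2

/-- `P` holds for the lists of length `k` whose entries are chosen one after the other, each of them
generic for the filter `U`. -/
def IteratedEventually (U : Filter ℕ) : ℕ → (List ℕ → Prop) → Prop
  | 0, P => P []
  | k + 1, P => ∀ᶠ p in U, IteratedEventually U k fun l ↦ P (p :: l)

namespace IteratedEventually

theorem of_forall {U : Filter ℕ} {k : ℕ} {P : List ℕ → Prop} (h : ∀ l, l.length = k → P l) :
    IteratedEventually U k P := by
  induction k generalizing P with
  | zero => exact h [] rfl
  | succ k ih => exact Filter.Eventually.of_forall fun p ↦ ih fun l hl ↦ h _ (by simp [hl])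

theorem mono {U : Filter ℕ} {k : ℕ} {P Q : List ℕ → Prop} (hP : IteratedEventually U k P)
    (h : ∀ l, l.length = k → P l → Q l) : IteratedEventually U k Q := by
  induction k generalizing P Q with
  | zero => exact h [] rfl hP
  | succ k ih => exact Filter.Eventually.mono hP fun p hp ↦ ih hp fun l hl ↦ h _ (by simp [hl])

theorem and {U : Filter ℕ} {k : ℕ} {P Q : List ℕ → Prop} (hP : IteratedEventually U k P)
    (hQ : IteratedEventually U k Q) : IteratedEventually U k fun l ↦ P l ∧ Q l := by
  induction k generalizing P Q with
  | zero => exact ⟨hP, hQ⟩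
  | succ k ih =>
    filter_upwards [hP, hQ] with p hp hq
    exact ih hp hq

theorem or_not (U : Ultrafilter ℕ) (k : ℕ) (P : List ℕ → Prop) :
    IteratedEventually U k P ∨ IteratedEventually U k fun l ↦ ¬ P l := by
  induction k generalizing P with
  | zero => exact em _
  | succ k ih => exact Ultrafilter.eventually_or.1 (Filter.Eventually.of_forall fun p ↦ ih _)

/-- Generic lists can be found among the increasing lists of arbitrarily many prescribed points. -/
theorem exists_strictMono {U : Filter ℕ} [U.NeBot] (hU : U ≤ Filter.atTop) {K : ℕ}
    {P : List ℕ → Prop} (hP : ∀ k ≤ K, IteratedEventually U k P) (N b : ℕ) :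
    ∃ t : ℕ → ℕ, StrictMono t ∧ b < t 0 ∧ ∀ l : List ℕ, l.Pairwise (· < ·) → l.length ≤ K →
      (∀ x ∈ l, ∃ i < N, t i = x) → P l := by
  induction N generalizing P b with
  | zero =>
    refine ⟨fun i ↦ b + 1 + i, fun i j h ↦ by simpa using h, by simp, fun l _ _ hl ↦ ?_⟩
    obtain rfl : l = [] := List.eq_nil_iff_forall_not_mem.2 fun x hx ↦ by simpa using hl x hx
    exact hP 0 K.zero_le
  | succ N ih =>
    have hev : ∀ᶠ p in U, ∀ k < K, IteratedEventually U k fun l ↦ P (p :: l) :=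
      (Set.finite_Iio K).eventually_all.2 fun k hk ↦ hP (k + 1) hk
    obtain ⟨p, hp, hbp⟩ := (hev.and ((Filter.eventually_gt_atTop b).filter_mono hU)).exists
    obtain ⟨t, ht, hpt, h⟩ := ih (P := fun l ↦ P l ∧ (l.length < K → P (p :: l)))
      (fun k hk ↦ (hP k hk).and <| by
        rcases hk.lt_or_eq with hk | rfl
        · exact (hp k hk).mono fun l _ h _ ↦ h
        · exact of_forall fun l hl h ↦ absurd hl h.ne) p
    refine ⟨fun i ↦ Nat.casesOn i p t, strictMono_nat_of_lt_succ fun i ↦ ?_, hbp,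
      fun l hl hK hlt ↦ ?_⟩
    · cases i with
      | zero => exact hpt
      | succ i => exact ht i.lt_succ_self
    have hmem (x : ℕ) (hx : ∃ i < N + 1, (Nat.casesOn i p t : ℕ) = x) (hpx : x ≠ p) :
        ∃ i < N, t i = x := by
      obtain ⟨_ | i, hi, rfl⟩ := hx
      · exact absurd rfl hpx
      · exact ⟨i, by omega, rfl⟩
    have hple (x : ℕ) (hx : ∃ i < N + 1, (Nat.casesOn i p t : ℕ) = x) : p ≤ x := by
      by_cases hpx : x = p
      · exact hpx.ge
      · obtain ⟨i, -, rfl⟩ := hmem x hx hpx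
        exact hpt.le.trans (ht.monotone i.zero_le)
    rcases l with _ | ⟨a, l⟩
    · exact hP 0 K.zero_le
    rw [List.pairwise_cons] at hl
    have hal : ∀ x ∈ l, ∃ i < N, t i = x := fun x hx ↦
      hmem x (hlt x (List.mem_cons_of_mem _ hx))
        ((hple a (hlt a List.mem_cons_self)).trans_lt (hl.1 x hx)).ne'
    by_cases hap : a = p
    · subst hap
      exact (h l hl.2 (Nat.le_of_succ_le hK) hal).2 hK
    · refine (h (a :: l) (List.pairwise_cons.2 hl) hK fun x hx ↦ ?_).1
      rcases List.mem_cons.1 hx with rfl | hx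
      · exact hmem x (hlt x List.mem_cons_self) hap
      · exact hal x hx

end IteratedEventually

/-- If `l` is increasing, there is a vector of norm at most `c` on which the functionals `ξ i` take
alternately the values `1` and `-1` for `i` in the consecutive blocks
`[l₀, l₁), [l₂, l₃), …`. -/
def HasAlternatingVector {Z : Type*} [NormedAddCommGroup Z] [NormedSpace ℝ Z]
    (ξ : ℕ → StrongDual ℝ Z) (c : ℝ) (l : List ℕ) : Prop :=
  l.Pairwise (· < ·) → ∃ y : Z, ‖y‖ ≤ c ∧ ∀ k, 2 * k + 1 < l.length →
    ∀ i, l.getD (2 * k) 0 ≤ i → i < l.getD (2 * k + 1) 0 → ξ i y = (-1) ^ k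

theorem HasAlternatingVector.mono {Z : Type*} [NormedAddCommGroup Z] [NormedSpace ℝ Z]
    {ξ : ℕ → StrongDual ℝ Z} {c d : ℝ} {l : List ℕ} (h : HasAlternatingVector ξ c l)
    (hcd : c ≤ d) : HasAlternatingVector ξ d l := fun hl ↦
  let ⟨y, hy, h⟩ := h hl
  ⟨y, hy.trans hcd, h⟩

theorem List.Pairwise.getD_lt_getD {l : List ℕ} (hl : l.Pairwise (· < ·)) {a b : ℕ} (hab : a < b)
    (hb : b < l.length) : l.getD a 0 < l.getD b 0 := by
  rw [List.getD_eq_getElem _ _ (hab.trans hb), List.getD_eq_getElem _ _ hb]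
  exact List.pairwise_iff_getElem.1 hl a b _ hb hab

theorem hasAlternatingVector_of_triangular {Z : Type*} [NormedAddCommGroup Z] [NormedSpace ℝ Z]
    {C : ℝ} {x : ℕ → Z} {ξ : ℕ → StrongDual ℝ Z} (hx : ∀ n, ‖x n‖ ≤ C)
    (hξ : ∀ n k, ξ n (x k) = if n < k then 1 else 0) (m : ℕ) {l : List ℕ} (hm : l.length = 2 * m) :
    HasAlternatingVector ξ (m * (2 * C)) l := by
  intro hl
  refine ⟨∑ k ∈ Finset.range m, (-1 : ℝ) ^ k • (x (l.getD (2 * k + 1) 0) - x (l.getD (2 * k) 0)),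
    ?_, fun k hk i hi hi' ↦ ?_⟩
  · refine (norm_sum_le_of_le _ fun k _ ↦ ?_).trans_eq
      (by rw [Finset.sum_const, Finset.card_range, nsmul_eq_mul])
    rw [norm_smul, norm_pow, norm_neg, norm_one, one_pow, one_mul, two_mul C]
    exact (norm_sub_le _ _).trans (add_le_add (hx _) (hx _))
  · rw [map_sum, Finset.sum_eq_single k]
    · rw [map_smul, map_sub, hξ, hξ, if_pos hi', if_neg hi.not_gt, sub_zero, smul_eq_mul, mul_one]
    · intro j hj hjk
      rw [Finset.mem_range] at hj
      have hlt : l.getD (2 * j) 0 < l.getD (2 * j + 1) 0 := hl.getD_lt_getD (by omega) (by omega)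
      rcases lt_or_gt_of_ne hjk with h | h
      · have := hl.getD_lt_getD (a := 2 * j + 1) (b := 2 * k) (by omega) (by omega)
        rw [map_smul, map_sub, hξ, hξ, if_neg (by omega), if_neg (by omega), sub_zero, smul_zero]
      · have := hl.getD_lt_getD (a := 2 * k + 1) (b := 2 * j) (by omega) (by omega)
        rw [map_smul, map_sub, hξ, hξ, if_pos (by omega), if_pos (by omega), sub_self, smul_zero]
    · intro h
      exact absurd (Finset.mem_range.2 (by omega)) h

/-- The minimal norm of alternating vectors grows at most linearly in the number of blocks, so it
grows by a factor less than `r` at some place. -/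
theorem exists_iteratedEventually_hasAlternatingVector {Z : Type*} [NormedAddCommGroup Z]
    [NormedSpace ℝ Z] {C D : ℝ} {x : ℕ → Z} {ξ : ℕ → StrongDual ℝ Z} (hx : ∀ n, ‖x n‖ ≤ C)
    (hD : ∀ n, ‖ξ n‖ ≤ D) (hξ : ∀ n k, ξ n (x k) = if n < k then 1 else 0)
    (U : Filter ℕ) [U.NeBot] (hU : U ≤ Filter.atTop) {r : ℝ} (hr : 1 < r) :
    ∃ m : ℕ, ∃ c > 0, IteratedEventually U (2 * (m + 1)) (HasAlternatingVector ξ (c * r)) ∧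
      ¬ IteratedEventually U (2 * m) (HasAlternatingVector ξ c) := by
  by_contra! h
  have hr0 : 0 < r := one_pos.trans hr
  have hD0 : 0 ≤ D := (norm_nonneg _).trans (hD 0)
  have descend (M : ℕ) : ∀ c > 0,
      IteratedEventually U (2 * (M + 1)) (HasAlternatingVector ξ (c * r ^ M)) →
      IteratedEventually U 2 (HasAlternatingVector ξ c) := by
    induction M with
    | zero => intro c _ hc; simpa using hc
    | succ M ih =>
      intro c hc hM
      refine ih c hc (h _ _ (by positivity) ?_)
      rwa [mul_assoc, ← pow_succ]
  set c : ℝ := (D + 1)⁻¹ with hc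
  have hc0 : 0 < c := by positivity
  obtain ⟨M, hM⟩ : ∃ M : ℕ, ((M + 1 : ℕ) : ℝ) * (2 * C) ≤ c * r ^ M := by
    have h0 := tendsto_pow_const_div_const_pow_of_one_lt 1 hr
    have h1 := tendsto_pow_const_div_const_pow_of_one_lt 0 hr
    have h2 := ((h0.add h1).mul_const (2 * C)).eventually_lt_const (u := c) (by simpa using hc0)
    obtain ⟨M, hM⟩ := h2.exists
    refine ⟨M, ?_⟩
    have hrM : 0 < r ^ M := by positivity
    have := mul_le_mul_of_nonneg_right hM.le hrM.le
    calc ((M + 1 : ℕ) : ℝ) * (2 * C) =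
          ((M : ℝ) ^ 1 / r ^ M + (M : ℝ) ^ 0 / r ^ M) * (2 * C) * r ^ M := by
          push_cast
          field_simp
      _ ≤ _ := this
  have h2 : IteratedEventually U 2 (HasAlternatingVector ξ c) :=
    descend M c hc0 (.of_forall fun l hl ↦
      (hasAlternatingVector_of_triangular hx hξ (M + 1) hl).mono hM)
  obtain ⟨p, hp⟩ := Filter.Eventually.exists (f := U) h2
  obtain ⟨q, hq, hpq⟩ := (Filter.Eventually.and (f := U) hp
    ((Filter.eventually_gt_atTop p).filter_mono hU)).exists
  obtain ⟨y, hy, hyq⟩ := (show HasAlternatingVector ξ c [p, q] from hq) (by simpa using hpq)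
  have h1 : ξ p y = 1 := by simpa using hyq 0 (by simp) p (by simp) (by simpa using hpq)
  have h3 : ‖ξ p y‖ ≤ D * c := ((ξ p).le_opNorm y).trans (mul_le_mul (hD p) hy (norm_nonneg _) hD0)
  rw [h1, norm_one, hc, ← div_eq_mul_inv, le_div_iff₀ (by positivity)] at h3
  linarith

/-- A nonreflexive Banach space contains flat sequences of every length, with constants arbitrarily
close to `1`. -/
theorem flatSequence_of_not_isReflexiveBanach {Z : Type} [NormedAddCommGroup Z] [NormedSpace ℝ Z]
    [CompleteSpace Z] (hZ : ¬ IsReflexiveBanach Z) {r : ℝ} (hr : 1 < r) (n : ℕ) :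
    FlatSequence Z r⁻¹ n := by
  obtain ⟨C, D, z, ξ, hz, hD, hξ⟩ := exists_triangular_system hZ
  let U : Ultrafilter ℕ := Filter.hyperfilter ℕ
  have hU : (U : Filter ℕ) ≤ Filter.atTop := Nat.hyperfilter_le_atTop
  obtain ⟨m, c, hc, hup, hlow⟩ :=
    exists_iteratedEventually_hasAlternatingVector hz hD hξ U hU hr
  replace hlow := (IteratedEventually.or_not U (2 * m) _).resolve_left hlow
  obtain ⟨t, ht, -, hQ⟩ := IteratedEventually.exists_strictMono hU (K := 2 * (m + 1))
    (P := fun l ↦ (l.length = 2 * (m + 1) → HasAlternatingVector ξ (c * r) l) ∧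
      (l.length = 2 * m → ¬ HasAlternatingVector ξ c l))
    (fun k _ ↦ by
      refine .and ?_ ?_
      · by_cases hk : k = 2 * (m + 1)
        · subst hk
          exact hup.mono fun l _ h _ ↦ h
        · exact .of_forall fun l hl h ↦ absurd (hl.symm.trans h) hk
      · by_cases hk : k = 2 * m
        · subst hk
          exact hlow.mono fun l _ h _ ↦ h
        · exact .of_forall fun l hl h ↦ absurd (hl.symm.trans h) hk)
    (2 * ((m + 2) * n) + 2) 0
  let L (σ : ℕ → ℕ) (k : ℕ) : List ℕ := (List.range k).map fun s ↦ t (σ s)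
  have hlen (σ : ℕ → ℕ) (k : ℕ) : (L σ k).length = k := by simp [L]
  have hget (σ : ℕ → ℕ) {k s : ℕ} (hs : s < k) : (L σ k).getD s 0 = t (σ s) := by
    simp [L, hs]
  have hsorted {σ : ℕ → ℕ} (hσ : StrictMono σ) (k : ℕ) : (L σ k).Pairwise (· < ·) :=
    List.pairwise_map.2 (List.pairwise_lt_range.imp fun h ↦ ht (hσ h))
  have hLQ {σ : ℕ → ℕ} (hσ : StrictMono σ) {k : ℕ} (hk : k ≤ 2 * (m + 1))
      (hσN : ∀ s < k, σ s < 2 * ((m + 2) * n) + 2) :=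
    hQ (L σ k) (hsorted hσ k) (by rwa [hlen]) fun y hy ↦ by
      obtain ⟨s, hs, rfl⟩ := List.mem_map.1 hy
      exact ⟨σ s, hσN s (List.mem_range.1 hs), rfl⟩
  -- the blocks of the `i`-th vector are `[t (2 (k n + i) + 1), t (2 ((k + 1) n + i)))`
  have hvec (i : ℕ) : ∃ y : Z, i < n → ‖y‖ ≤ c * r ∧ ∀ k < m + 1, ∀ q,
      t (2 * (k * n + i) + 1) ≤ q → q < t (2 * ((k + 1) * n + i)) → ξ q y = (-1) ^ k := by
    by_cases hi : i < n
    swap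
    · exact ⟨0, fun h ↦ absurd h hi⟩
    let σ (s : ℕ) : ℕ := 2 * ((s + 1) / 2 * n + i) + (1 - s % 2)
    have hσe (k : ℕ) : σ (2 * k) = 2 * (k * n + i) + 1 := by
      simp only [σ]
      rw [show (2 * k + 1) / 2 = k by omega, show 1 - 2 * k % 2 = 1 by omega]
    have hσo (k : ℕ) : σ (2 * k + 1) = 2 * ((k + 1) * n + i) := by
      simp only [σ]
      rw [show (2 * k + 1 + 1) / 2 = k + 1 by omega, show 1 - (2 * k + 1) % 2 = 0 by omega,
        add_zero]
    have hσ : StrictMono σ := strictMono_nat_of_lt_succ fun s ↦ by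
      obtain ⟨k, rfl | rfl⟩ := s.even_or_odd'
      · rw [hσe, hσo, add_mul]
        omega
      · rw [show 2 * k + 1 + 1 = 2 * (k + 1) by ring, hσe, hσo]
        omega
    obtain ⟨y, hy, hyk⟩ := (hLQ hσ le_rfl fun s hs ↦ by
      refine (hσ.monotone (show s ≤ 2 * m + 1 by omega)).trans_lt ?_
      rw [hσo, show (m + 2) * n = (m + 1) * n + n by ring]
      omega).1 (hlen _ _) (hsorted hσ _)
    refine ⟨y, fun _ ↦ ⟨hy, fun k hk q hq hq' ↦ hyk k ?_ q ?_ ?_⟩⟩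
    · rw [hlen]; omega
    · rwa [hget _ (by omega), hσe]
    · rwa [hget _ (by omega), hσo]
  choose x hx using hvec
  have key (j : ℕ) (hj : 1 ≤ j) (hjn : j ≤ n) (a : ℕ → ℝ) :
      c * |∑ i ∈ Finset.Ico j n, a i - ∑ i ∈ Finset.range j, a i| ≤
        ‖∑ i ∈ Finset.range n, a i • x i‖ := by
    obtain ⟨j, rfl⟩ := Nat.exists_eq_succ_of_ne_zero (Nat.one_le_iff_ne_zero.1 hj)
    set w := ∑ i ∈ Finset.Ico (j + 1) n, a i - ∑ i ∈ Finset.range (j + 1), a i with hw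
    set v := ∑ i ∈ Finset.range n, a i • x i with hv
    by_cases hw0 : w = 0
    · simp [hw0]
    by_contra! hlt
    let τ (s : ℕ) : ℕ := 2 * ((s / 2 + 1) * n + j) + 1 + s % 2
    have hτe (k : ℕ) : τ (2 * k) = 2 * ((k + 1) * n + j) + 1 := by
      simp only [τ]
      rw [show 2 * k / 2 = k by omega, show 2 * k % 2 = 0 by omega, add_zero]
    have hτo (k : ℕ) : τ (2 * k + 1) = 2 * ((k + 1) * n + j) + 2 := by
      simp only [τ]
      rw [show (2 * k + 1) / 2 = k by omega, show (2 * k + 1) % 2 = 1 by omega]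
    have hτ : StrictMono τ := strictMono_nat_of_lt_succ fun s ↦ by
      obtain ⟨k, rfl | rfl⟩ := s.even_or_odd'
      · rw [hτe, hτo]
        omega
      · rw [show 2 * k + 1 + 1 = 2 * (k + 1) by ring, hτe, hτo, add_mul (k + 1)]
        omega
    refine (hLQ hτ (k := 2 * m) (by omega) fun s hs ↦ ?_).2 (hlen _ _)
      fun _ ↦ ⟨w⁻¹ • v, ?_, fun k hk q hq hq' ↦ ?_⟩
    · obtain ⟨m, rfl⟩ : ∃ m', m = m' + 1 := Nat.exists_eq_succ_of_ne_zero (by omega)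
      refine (hτ.monotone (show s ≤ 2 * m + 1 by omega)).trans_lt ?_
      rw [hτo, show (m + 1 + 2) * n = (m + 1) * n + 2 * n by ring]
      omega
    · rw [norm_smul, norm_inv, Real.norm_eq_abs, inv_mul_le_iff₀ (abs_pos.2 hw0), mul_comm]
      exact hlt.le
    · rw [hlen] at hk
      rw [hget _ (by omega), hτe] at hq
      rw [hget _ (by omega), hτo] at hq'
      have h1 (i : ℕ) (hi : i ∈ Finset.range (j + 1)) : ξ q (a i • x i) = (-1) ^ (k + 1) * a i := by
        rw [Finset.mem_range] at hi
        rw [map_smul, smul_eq_mul, mul_comm, (hx i (by omega)).2 (k + 1) (by omega) q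
          (le_trans (ht.monotone (by omega)) hq)
          (hq'.trans_le (ht.monotone (by rw [add_mul (k + 1)]; omega)))]
      have h2 (i : ℕ) (hi : i ∈ Finset.Ico (j + 1) n) : ξ q (a i • x i) = (-1) ^ k * a i := by
        rw [Finset.mem_Ico] at hi
        rw [map_smul, smul_eq_mul, mul_comm, (hx i (by omega)).2 k (by omega) q
          (le_trans (ht.monotone (by rw [add_mul k]; omega)) hq)
          (hq'.trans_le (ht.monotone (by omega)))]
      rw [map_smul, smul_eq_mul, inv_mul_eq_iff_eq_mul₀ hw0, hv,
        ← Finset.sum_range_add_sum_Ico _ hjn, map_add, map_sum, map_sum, Finset.sum_congr rfl h1,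
        Finset.sum_congr rfl h2, ← Finset.mul_sum, ← Finset.mul_sum, hw]
      ring
  have hr0 : 0 < r := one_pos.trans hr
  refine ⟨fun i ↦ (c * r)⁻¹ • x i, fun i hi ↦ ?_, fun j hj hjn a ↦ ?_⟩
  · rw [norm_smul, norm_inv, Real.norm_of_nonneg (by positivity), inv_mul_le_iff₀ (by positivity),
      mul_one]
    exact (hx i hi).1
  · simp_rw [smul_comm (a _)]
    rw [← Finset.smul_sum, norm_smul, norm_inv, Real.norm_of_nonneg (by positivity), mul_inv_rev,
      mul_assoc]
    gcongr
    rw [le_inv_mul_iff₀ hc]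
    have h1 := key j hj (by omega) a
    have h2 := key n (by omega) le_rfl a
    rw [Finset.Ico_self, Finset.sum_empty, zero_sub, abs_neg,
      ← Finset.sum_range_add_sum_Ico _ (show j ≤ n by omega)] at h2
    refine le_trans ?_ (max_le h1 h2)
    rw [← mul_max_of_nonneg _ _ hc.le]
    gcongr
    rw [le_max_iff]
    grind

theorem FlatSequence.of_finitelyRepresentable {Z X : Type} [NormedAddCommGroup Z] [NormedSpace ℝ Z]
    [NormedAddCommGroup X] [NormedSpace ℝ X] (hZX : FinitelyRepresentable Z X) {α ε : ℝ}
    (hε : 0 < ε) {m : ℕ} (hZ : FlatSequence Z (α * (1 + ε)) m) : FlatSequence X α m := by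
  obtain ⟨x, hx, hflat⟩ := hZ
  let F : Submodule ℝ Z := Submodule.span ℝ (x '' Set.Iio m)
  have hF : FiniteDimensional ℝ F :=
    FiniteDimensional.span_of_finite ℝ ((Set.finite_Iio m).image x)
  obtain ⟨G, -, T, hT⟩ := hZX ε hε F hF
  have hxF (i : ℕ) : ∃ f : F, i < m → (f : Z) = x i := by
    by_cases hi : i < m
    · exact ⟨⟨x i, Submodule.subset_span ⟨i, hi, rfl⟩⟩, fun _ ↦ rfl⟩
    · exact ⟨0, fun h ↦ absurd h hi⟩
  choose f hf using hxF
  set N : ℝ := ‖(T : F →L[ℝ] G)‖ with hN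
  have hN0 : 0 ≤ N := norm_nonneg (T : F →L[ℝ] G)
  refine ⟨fun i ↦ N⁻¹ • (T (f i) : X), fun i hi ↦ ?_, fun j hj hjm a ↦ ?_⟩
  · rw [norm_smul, norm_inv, Real.norm_of_nonneg hN0]
    refine inv_mul_le_one_of_le₀ ?_ hN0
    refine ((T : F →L[ℝ] G).le_opNorm (f i)).trans (mul_le_of_le_one_right (norm_nonneg _) ?_)
    rw [← Submodule.norm_coe, hf i hi]
    exact hx i hi
  · set v : F := ∑ i ∈ Finset.range m, a i • f i with hv
    set S : ℝ := |∑ i ∈ Finset.range j, a i| + |∑ i ∈ Finset.Ico j m, a i| with hS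
    have hvx : (v : Z) = ∑ i ∈ Finset.range m, a i • x i := by
      rw [hv, Submodule.coe_sum]
      refine Finset.sum_congr rfl fun i hi ↦ ?_
      rw [Submodule.coe_smul, hf i (Finset.mem_range.1 hi)]
    have hTv : ∑ i ∈ Finset.range m, a i • N⁻¹ • (T (f i) : X) = N⁻¹ • (T v : X) := by
      rw [hv, map_sum, Submodule.coe_sum, Finset.smul_sum]
      refine Finset.sum_congr rfl fun i _ ↦ ?_
      rw [map_smul, Submodule.coe_smul, smul_comm]
    have hle : α * (1 + ε) * S ≤ ‖v‖ := by
      rw [← Submodule.norm_coe, hvx]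
      exact hflat j hj hjm a
    rw [hTv, norm_smul, norm_inv, Real.norm_of_nonneg hN0, Submodule.norm_coe]
    rcases hN0.eq_or_lt' with h0 | h0
    · have hv0 : v = 0 := by
        have h1 := (T : F →L[ℝ] G).le_opNorm v
        rw [← hN, h0, zero_mul] at h1
        exact T.map_eq_zero_iff.1 (norm_le_zero_iff.1 h1)
      rw [hv0, norm_zero] at hle
      have : α * S ≤ 0 := by nlinarith
      exact this.trans (by positivity)
    · have h1 : ‖v‖ ≤ ‖(T.symm : G →L[ℝ] F)‖ * ‖T v‖ := by
        simpa using (T.symm : G →L[ℝ] F).le_opNorm (T v)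
      have h2 : ‖v‖ ≤ (1 + ε) * (N⁻¹ * ‖T v‖) := by
        refine h1.trans ?_
        calc ‖(T.symm : G →L[ℝ] F)‖ * ‖T v‖
            = N * ‖(T.symm : G →L[ℝ] F)‖ * (N⁻¹ * ‖T v‖) := by
              have : N ≠ 0 := h0.ne'
              field_simp
          _ ≤ _ := by gcongr
      have h3 : (1 + ε) * (α * S) ≤ (1 + ε) * (N⁻¹ * ‖T v‖) := by linarith
      exact le_of_mul_le_mul_left h3 (by linarith)

/-- A sequence that is flat at all lengths rules out reflexivity. -/
theorem not_isReflexiveBanach_of_flat {Z : Type} [NormedAddCommGroup Z] [NormedSpace ℝ Z]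
    {α : ℝ} (hα : 0 < α) {e : ℕ → Z} (he : ∀ i, ‖e i‖ ≤ 1)
    (hflat : ∀ m j, 1 ≤ j → j ≤ m - 1 → ∀ a : ℕ → ℝ,
      α * (|∑ i ∈ Finset.range j, a i| + |∑ i ∈ Finset.Ico j m, a i|) ≤
        ‖∑ i ∈ Finset.range m, a i • e i‖) : ¬ IsReflexiveBanach Z := by
  intro hZ
  let U : Ultrafilter ℕ := Filter.hyperfilter ℕ
  have hU : (U : Filter ℕ) ≤ Filter.atTop := Nat.hyperfilter_le_atTop
  have hlim (f : StrongDual ℝ Z) : ∃ y ∈ Metric.closedBall (0 : ℝ) ‖f‖,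
      Filter.Tendsto (fun i ↦ f (e i)) U (nhds y) :=
    (isCompact_closedBall (0 : ℝ) ‖f‖).ultrafilter_le_nhds (U.map fun i ↦ f (e i))
      (Filter.le_principal_iff.2 (Filter.eventually_map.2 <| Filter.Eventually.of_forall fun i ↦
        mem_closedBall_zero_iff.2 (f.le_of_opNorm_le_of_le le_rfl (he i) |>.trans_eq (mul_one _))))
  choose φ hφ hlim using hlim
  let Φ : StrongDual ℝ (StrongDual ℝ Z) := LinearMap.mkContinuous
    { toFun := φ
      map_add' := fun f g ↦ tendsto_nhds_unique (hlim (f + g)) ((hlim f).add (hlim g))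
      map_smul' := fun c f ↦ tendsto_nhds_unique (hlim (c • f)) ((hlim f).const_smul c) } 1
    fun f ↦ by simpa using hφ f
  obtain ⟨z, hz⟩ := hZ Φ
  have hzlim (f : StrongDual ℝ Z) : Filter.Tendsto (fun i ↦ f (e i)) U (nhds (f z)) := by
    have : f z = φ f := DFunLike.congr_fun hz f
    rw [this]
    exact hlim f
  have happrox (j : ℕ) : ∃ a : ℕ →₀ ℝ, ((∀ i < j, a i = 0) ∧ a.sum (fun _ c ↦ c) = 1) ∧
      ‖z - Finsupp.linearCombination ℝ e a‖ < α / 2 := by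
    let A : Set (ℕ →₀ ℝ) := {a | (∀ i < j, a i = 0) ∧ a.sum (fun _ c ↦ c) = 1}
    have hA : Convex ℝ A := by
      rintro a ⟨ha, ha'⟩ b ⟨hb, hb'⟩ s t - - hst
      refine ⟨fun i hi ↦ by simp [ha i hi, hb i hi], ?_⟩
      rw [Finsupp.sum_add_index' (fun _ ↦ rfl) (fun _ _ _ ↦ rfl),
        Finsupp.sum_smul_index' (fun _ ↦ rfl), Finsupp.sum_smul_index' (fun _ ↦ rfl),
        ← Finsupp.smul_sum, ← Finsupp.smul_sum, ha', hb']
      simpa using hst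
    let C : Set Z := closure (Finsupp.linearCombination ℝ e '' A)
    have hzC : z ∈ C := by
      by_contra hzC
      obtain ⟨f, u, hfz, hfu⟩ := geometric_hahn_banach_point_closed
        (hA.linear_image (Finsupp.linearCombination ℝ e)).closure isClosed_closure hzC
      have h1 := (hzlim f).eventually_lt_const hfz
      obtain ⟨i, hi, hji⟩ := (h1.and ((Filter.eventually_ge_atTop j).filter_mono hU)).exists
      refine (hfu (e i) (subset_closure ⟨Finsupp.single i 1, ⟨fun k hk ↦ ?_, ?_⟩, ?_⟩)).not_gt hi
      · rw [Finsupp.single_apply, if_neg (by omega)]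
      · simp
      · simp
    obtain ⟨_, ⟨a, ha, rfl⟩, hza⟩ := Metric.mem_closure_iff.1 hzC (α / 2) (by positivity)
    exact ⟨a, ha, by rwa [dist_eq_norm] at hza⟩
  have hsupp (a : ℕ →₀ ℝ) : ∃ n, ∀ i ≥ n, a i = 0 :=
    (Filter.eventually_atTop.1
      (Nat.cofinite_eq_atTop ▸ a.support.finite_toSet.eventually_cofinite_notMem)).imp
      fun n hn i hi ↦ Finsupp.notMem_support_iff.1 (hn i hi)
  have hrange {a : ℕ →₀ ℝ} {n : ℕ} (ha : ∀ i ≥ n, a i = 0) : a.support ⊆ Finset.range n :=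
    fun i hi ↦ Finset.mem_range.2 (lt_of_not_ge fun h ↦ Finsupp.mem_support_iff.1 hi (ha i h))
  obtain ⟨a, ⟨-, ha1⟩, haz⟩ := happrox 0
  obtain ⟨n, hn⟩ := hsupp a
  obtain ⟨b, ⟨hb0, hb1⟩, hbz⟩ := happrox (n + 1)
  obtain ⟨m, hm⟩ := hsupp b
  have ham : ∀ i ≥ n + 1, a i = 0 := fun i hi ↦ hn i (by omega)
  have hsum {c : ℕ →₀ ℝ} {k : ℕ} (hc : ∀ i ≥ k, c i = 0) :
      c.sum (fun _ c ↦ c) = ∑ i ∈ Finset.range k, c i :=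
    Finsupp.sum_of_support_subset _ (hrange hc) _ fun _ _ ↦ rfl
  have hcomb {c : ℕ →₀ ℝ} {k : ℕ} (hc : ∀ i ≥ k, c i = 0) :
      Finsupp.linearCombination ℝ e c = ∑ i ∈ Finset.range k, c i • e i :=
    Finsupp.sum_of_support_subset _ (hrange hc) _ fun _ _ ↦ zero_smul _ _
  have h := hflat (n + 2 + m) (n + 1) (by omega) (by omega) fun i ↦ a i - b i
  have hA1 : ∑ i ∈ Finset.range (n + 1), (a i - b i) = 1 := by
    rw [← ha1, hsum ham]
    exact Finset.sum_congr rfl fun i hi ↦ by rw [hb0 i (Finset.mem_range.1 hi), sub_zero]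
  have hB1 : ∑ i ∈ Finset.Ico (n + 1) (n + 2 + m), (a i - b i) = -1 := by
    rw [Finset.sum_Ico_eq_sub _ (by omega), hA1, Finset.sum_sub_distrib,
      ← hsum (c := a) fun i hi ↦ hn i (by omega), ← hsum (c := b) fun i hi ↦ hm i (by omega),
      ha1, hb1]
    norm_num
  rw [hA1, hB1] at h
  simp_rw [sub_smul] at h
  rw [Finset.sum_sub_distrib, ← hcomb (c := a) fun i hi ↦ hn i (by omega),
    ← hcomb (c := b) fun i hi ↦ hm i (by omega)] at h
  have h3 := norm_sub_le_norm_sub_add_norm_sub (Finsupp.linearCombination ℝ e a) z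
    (Finsupp.linearCombination ℝ e b)
  rw [norm_sub_rev _ z] at h3
  norm_num at h
  linarith

open BoundedContinuousFunction in
/-- The bounded sequences which converge to zero in norm along `U`. -/
def ultraNull (U : Ultrafilter ℕ) (X : Type) [NormedAddCommGroup X] [NormedSpace ℝ X] :
    Submodule ℝ (ℕ →ᵇ X) where
  carrier := {f | Filter.Tendsto f U (nhds 0)}
  zero_mem' := tendsto_const_nhds
  add_mem' hf hg := by simpa [Pi.add_def] using Filter.Tendsto.add hf hg
  smul_mem' c f hf := by simpa using hf.const_smul c

section Ultrapower

open BoundedContinuousFunction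

variable {U : Ultrafilter ℕ} {X : Type} [NormedAddCommGroup X] [NormedSpace ℝ X]

instance isClosed_ultraNull : IsClosed (ultraNull U X : Set (ℕ →ᵇ X)) := by
  refine isClosed_of_closure_subset fun f hf ↦ ?_
  refine Metric.tendsto_nhds.2 fun ε hε ↦ ?_
  obtain ⟨g, hg, hfg⟩ := Metric.mem_closure_iff.1 hf (ε / 2) (by positivity)
  filter_upwards [Metric.tendsto_nhds.1 hg (ε / 2) (by positivity)] with n hn
  calc dist (f n) 0 ≤ dist (f n) (g n) + dist (g n) 0 := dist_triangle _ _ _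
    _ ≤ dist f g + dist (g n) 0 := by gcongr; exact dist_coe_le_dist n
    _ < ε := by linarith

/-- The norm of an element of the ultrapower is at least the limit of the norms. -/
theorem eventually_norm_lt_of_norm_mkQ_lt {f : ℕ →ᵇ X} {c : ℝ} (h : ‖(ultraNull U X).mkQ f‖ < c) :
    ∀ᶠ n in U, ‖f n‖ < c := by
  obtain ⟨g, hg, hgc⟩ := Submodule.Quotient.norm_mk_lt ((ultraNull U X).mkQ f) (sub_pos.2 h)
  have hfg : f - g ∈ ultraNull U X := (Submodule.Quotient.eq _).1 hg.symm
  have hgc : 0 < c - ‖g‖ := by linarith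
  filter_upwards [Metric.tendsto_nhds.1 (show Filter.Tendsto (f - g) U (nhds 0) from hfg) _ hgc]
    with n hn
  rw [dist_zero_right, BoundedContinuousFunction.sub_apply] at hn
  have h1 := norm_add_le (f n - g n) (g n)
  rw [sub_add_cancel] at h1
  linarith [g.norm_coe_le_norm n]

/-- The norm of an element of the ultrapower is at most the limit of the norms. -/
theorem norm_mkQ_le_of_eventually_norm_le {f : ℕ →ᵇ X} {c : ℝ} (h : ∀ᶠ n in U, ‖f n‖ ≤ c) :
    ‖(ultraNull U X).mkQ f‖ ≤ c := by
  classical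
  have hc : 0 ≤ c := let ⟨n, hn⟩ := h.exists; (norm_nonneg _).trans hn
  have hbound (n : ℕ) : ‖if ‖f n‖ ≤ c then f n else 0‖ ≤ c := by split_ifs <;> simpa
  let g : ℕ →ᵇ X := ofNormedAddCommGroupDiscrete (fun n ↦ if ‖f n‖ ≤ c then f n else 0) c hbound
  have hfg : (ultraNull U X).mkQ f = (ultraNull U X).mkQ g := by
    refine (Submodule.Quotient.eq _).2 (tendsto_const_nhds.congr' ?_)
    filter_upwards [h] with n hn
    simp [g, hn]
  rw [hfg]
  exact (Submodule.Quotient.norm_mk_le _ g).trans ((g.norm_le hc).2 hbound)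

theorem eventually_lt_norm_of_lt_norm_mkQ {f : ℕ →ᵇ X} {c : ℝ} (h : c < ‖(ultraNull U X).mkQ f‖) :
    ∀ᶠ n in U, c < ‖f n‖ := by
  by_contra hc
  rw [← Ultrafilter.eventually_not] at hc
  exact h.not_ge (norm_mkQ_le_of_eventually_norm_le (hc.mono fun _ ↦ le_of_not_gt))

/-- Coordinates of a linear lift of a finite-dimensional space of the ultrapower are almost
isometric. -/
theorem exists_forall_norm_approx {F : Type} [NormedAddCommGroup F] [NormedSpace ℝ F]
    [FiniteDimensional ℝ F] (s : F →ₗ[ℝ] (ℕ →ᵇ X))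
    (hs : ∀ f, ‖(ultraNull U X).mkQ (s f)‖ = ‖f‖) {δ : ℝ} (hδ : 0 < δ) :
    ∃ n, ∀ f, (1 - δ) * ‖f‖ ≤ ‖s f n‖ ∧ ‖s f n‖ ≤ (1 + δ) * ‖f‖ := by
  have := FiniteDimensional.proper_real F
  let S := LinearMap.toContinuousLinearMap s
  set η : ℝ := δ / (2 * (‖S‖ + 1)) with hη
  have hSη : ‖S‖ * η ≤ δ / 2 := by
    rw [hη, mul_div_assoc', div_le_div_iff₀ (by positivity) two_pos]
    nlinarith [norm_nonneg S]
  obtain ⟨t, hts, htf, hcover⟩ := (isCompact_sphere (0 : F) 1).finite_cover_balls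
    (show 0 < η by positivity)
  have hev : ∀ᶠ n in U, ∀ y ∈ t, 1 - δ / 2 < ‖s y n‖ ∧ ‖s y n‖ < 1 + δ / 2 := by
    refine htf.eventually_all.2 fun y hy ↦ ?_
    have hy1 : ‖(ultraNull U X).mkQ (s y)‖ = 1 :=
      (hs y).trans (mem_sphere_zero_iff_norm.1 (hts hy))
    exact (eventually_lt_norm_of_lt_norm_mkQ (by linarith)).and
      (eventually_norm_lt_of_norm_mkQ_lt (by linarith))
  obtain ⟨n, hn⟩ := hev.exists
  have hunit (f : F) (hf : ‖f‖ = 1) : 1 - δ ≤ ‖s f n‖ ∧ ‖s f n‖ ≤ 1 + δ := by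
    obtain ⟨y, hy, hfy⟩ := Set.mem_iUnion₂.1 (hcover (mem_sphere_zero_iff_norm.2 hf))
    rw [mem_ball_iff_norm] at hfy
    have h1 : ‖s f n - s y n‖ ≤ δ / 2 := by
      rw [← BoundedContinuousFunction.sub_apply, ← map_sub]
      refine ((s (f - y)).norm_coe_le_norm n).trans ((S.le_opNorm (f - y)).trans ?_)
      exact (mul_le_mul_of_nonneg_left hfy.le (norm_nonneg _)).trans hSη
    have h2 := abs_le.1 ((abs_norm_sub_norm_le (s f n) (s y n)).trans h1)
    obtain ⟨h3, h4⟩ := hn y hy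
    constructor <;> linarith [h2.1, h2.2]
  refine ⟨n, fun f ↦ ?_⟩
  rcases eq_or_ne f 0 with rfl | hf
  · simp
  have hf0 : 0 < ‖f‖ := norm_pos_iff.2 hf
  have h := hunit (‖f‖⁻¹ • f) (by rw [norm_smul, norm_inv, norm_norm, inv_mul_cancel₀ hf0.ne'])
  rw [map_smul, BoundedContinuousFunction.smul_apply, norm_smul, norm_inv, norm_norm,
    le_inv_mul_iff₀ hf0, inv_mul_le_iff₀ hf0] at h
  constructor <;> linarith [h.1, h.2]

theorem finitelyRepresentable_ultrapower (U : Ultrafilter ℕ) (X : Type) [NormedAddCommGroup X]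
    [NormedSpace ℝ X] : FinitelyRepresentable ((ℕ →ᵇ X) ⧸ ultraNull U X) X := by
  intro ε hε F hF
  obtain ⟨σ, hσ⟩ := (ultraNull U X).mkQ.exists_rightInverse_of_surjective
    (Submodule.range_mkQ _)
  let s : F →ₗ[ℝ] (ℕ →ᵇ X) := σ ∘ₗ F.subtype
  have hs (f : F) : (ultraNull U X).mkQ (s f) = f := LinearMap.congr_fun hσ (f : _ ⧸ ultraNull U X)
  set δ : ℝ := ε / (2 + ε) with hδ
  have hδ1 : δ < 1 := by rw [hδ, div_lt_one (by positivity)]; linarith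
  obtain ⟨n, hn⟩ := exists_forall_norm_approx (U := U) s (fun f ↦ by rw [hs, Submodule.norm_coe])
    (show 0 < δ by positivity)
  let T₀ : F →ₗ[ℝ] X :=
    { toFun := fun f ↦ s f n
      map_add' := fun f g ↦ by rw [map_add, BoundedContinuousFunction.add_apply]
      map_smul' := fun c f ↦ by rw [map_smul, BoundedContinuousFunction.smul_apply]; rfl }
  have hinj : Function.Injective T₀ := (injective_iff_map_eq_zero T₀).2 fun f hf ↦ by
    have h1 := (hn f).1
    rw [show s f n = 0 from hf, norm_zero] at h1
    exact norm_le_zero_iff.1 (nonpos_of_mul_nonpos_right h1 (by linarith))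
  refine ⟨LinearMap.range T₀, inferInstance,
    (LinearEquiv.ofInjective T₀ hinj).toContinuousLinearEquiv, ?_⟩
  set T := (LinearEquiv.ofInjective T₀ hinj).toContinuousLinearEquiv
  have hT (f : F) : ‖T f‖ = ‖s f n‖ := rfl
  have h1 : ‖(T : F →L[ℝ] LinearMap.range T₀)‖ ≤ 1 + δ :=
    ContinuousLinearMap.opNorm_le_bound _ (by positivity) fun f ↦ (hn f).2
  have h2 : ‖(T.symm : LinearMap.range T₀ →L[ℝ] F)‖ ≤ (1 - δ)⁻¹ := by
    refine ContinuousLinearMap.opNorm_le_bound _ (inv_nonneg.2 (by linarith)) fun y ↦ ?_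
    rw [inv_mul_eq_div, le_div_iff₀ (by linarith), mul_comm]
    have h3 := (hn (T.symm y)).1
    rwa [← hT, T.apply_symm_apply] at h3
  calc _ ≤ (1 + δ) * (1 - δ)⁻¹ := by gcongr
    _ = 1 + ε := by
      rw [← div_eq_mul_inv, div_eq_iff (by linarith), hδ]
      field_simp
      ring

/-- Arbitrarily long flat sequences in `X` combine to an infinite one in the ultrapower. -/
theorem not_isReflexiveBanach_ultrapower {α : ℝ} (hα : 0 < α) (hX : ∀ m, FlatSequence X α m) :
    ¬ IsReflexiveBanach ((ℕ →ᵇ X) ⧸ ultraNull (Filter.hyperfilter ℕ) X) := by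
  choose x hx hflat using hX
  have hbound (i n : ℕ) : ‖if i < n then x n i else 0‖ ≤ 1 := by
    split_ifs with h
    · exact hx n i h
    · simp
  let e (i : ℕ) : ℕ →ᵇ X := ofNormedAddCommGroupDiscrete (fun n ↦ if i < n then x n i else 0) 1
    (hbound i)
  refine not_isReflexiveBanach_of_flat hα (e := fun i ↦ Submodule.mkQ _ (e i))
    (fun i ↦ (Submodule.Quotient.norm_mk_le _ (e i)).trans
      (((e i).norm_le zero_le_one).2 (hbound i))) fun m j hj hjm a ↦ ?_
  by_contra! hlt
  simp_rw [← map_smul, ← map_sum] at hlt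
  obtain ⟨n, hn, hmn⟩ := ((eventually_norm_lt_of_norm_mkQ_lt hlt).and
    ((Filter.eventually_ge_atTop m).filter_mono Nat.hyperfilter_le_atTop)).exists
  refine hn.not_ge ?_
  have h := hflat n j hj (by omega) fun i ↦ if i < m then a i else 0
  have h1 : ∑ i ∈ Finset.range j, (if i < m then a i else 0) = ∑ i ∈ Finset.range j, a i :=
    Finset.sum_congr rfl fun i hi ↦ if_pos (by rw [Finset.mem_range] at hi; omega)
  have h2 : ∑ i ∈ Finset.Ico j n, (if i < m then a i else 0) = ∑ i ∈ Finset.Ico j m, a i := by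
    rw [← Finset.sum_Ico_consecutive _ (show j ≤ m by omega) hmn,
      Finset.sum_congr rfl fun i hi ↦ if_pos (Finset.mem_Ico.1 hi).2, add_eq_left]
    exact Finset.sum_eq_zero fun i hi ↦ if_neg (Finset.mem_Ico.1 hi).1.not_gt
  have h3 : ∑ i ∈ Finset.range n, (if i < m then a i else 0) • x n i =
      (∑ i ∈ Finset.range m, a i • e i) n := by
    rw [← Finset.sum_range_add_sum_Ico _ hmn, BoundedContinuousFunction.sum_apply,
      Finset.sum_eq_zero (s := Finset.Ico m n), add_zero]
    · refine Finset.sum_congr rfl fun i hi ↦ ?_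
      rw [Finset.mem_range] at hi
      rw [if_pos hi, BoundedContinuousFunction.smul_apply]
      exact congrArg (a i • ·) (if_pos (hi.trans_le hmn)).symm
    · exact fun i hi ↦ by rw [if_neg (Finset.mem_Ico.1 hi).1.not_gt, zero_smul]
  rwa [h1, h2, h3] at h

end Ultrapower

/-- James' characterization of non-superreflexivity. -/
theorem james_characterization_of_superreflexivity
    (X : Type) [NormedAddCommGroup X] [NormedSpace ℝ X] [CompleteSpace X] :
    (¬ SuperReflexive X ↔ ∃ α : ℝ, 0 < α ∧ α ≤ 1 ∧ ∀ m : ℕ, FlatSequence X α m) ∧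
    (¬ SuperReflexive X ↔ ∀ α : ℝ, 0 < α → α < 1 → ∀ m : ℕ, FlatSequence X α m) := by
  have h13 : ¬ SuperReflexive X → ∀ α : ℝ, 0 < α → α < 1 → ∀ m : ℕ, FlatSequence X α m := by
    intro hX α hα hα1 m
    simp only [SuperReflexive, not_forall] at hX
    obtain ⟨Z, _, _, _, hZX, hZ⟩ := hX
    obtain ⟨r, hr, hrα⟩ := exists_between ((one_lt_inv₀ hα).2 hα1)
    have hr0 : 0 < r := one_pos.trans hr
    have hαr : α * r < 1 := by
      have h := mul_lt_mul_of_pos_left hrα hα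
      rwa [mul_inv_cancel₀ hα.ne'] at h
    refine FlatSequence.of_finitelyRepresentable hZX (ε := (α * r)⁻¹ - 1)
      (sub_pos.2 ((one_lt_inv₀ (by positivity)).2 hαr)) ?_
    convert flatSequence_of_not_isReflexiveBanach hZ hr m using 1
    field_simp
    ring
  have h32 : (∀ α : ℝ, 0 < α → α < 1 → ∀ m : ℕ, FlatSequence X α m) →
      ∃ α : ℝ, 0 < α ∧ α ≤ 1 ∧ ∀ m : ℕ, FlatSequence X α m :=
    fun h ↦ ⟨1 / 2, by norm_num, by norm_num, h _ (by norm_num) (by norm_num)⟩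
  have h21 : (∃ α : ℝ, 0 < α ∧ α ≤ 1 ∧ ∀ m : ℕ, FlatSequence X α m) → ¬ SuperReflexive X := by
    rintro ⟨α, hα, -, h⟩ hX
    exact not_isReflexiveBanach_ultrapower hα h (hX _ (finitelyRepresentable_ultrapower _ X))
  exact ⟨⟨h32 ∘ h13, h21⟩, ⟨h13, h21 ∘ h32⟩⟩
end
end

section
/- A Banach space X is not superreflexive if and only if there exists a constant 1 ≤ C < ∞ such that for every n ∈ ℕ the binary tree T_n of depth n admits a bilipschitz embedding into X with distortion at most C. -/
noncomputable section

/-- The length of the longest common initial segment of two `{0,1}`-sequences. -/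
def lcp : List Bool → List Bool → ℕ
  | a :: s, b :: t => if a = b then lcp s t + 1 else 0
  | _, _ => 0

/-- The tree distance `d(s,t) = |s| + |t| − 2ℓ(s,t)` on finite `{0,1}`-sequences. -/
def treeDist (s t : List Bool) : ℝ :=
  (s.length : ℝ) + (t.length : ℝ) - 2 * (lcp s t : ℝ)

/-- The binary tree of depth `n`: all `{0,1}`-sequences of length at most `n`. -/
def BinTree (n : ℕ) := {l : List Bool // l.length ≤ n}

section Goldstine

variable {E : Type*} [NormedAddCommGroup E] [NormedSpace ℝ E]

/-- An approximate form of Helly's theorem, equivalent to Goldstine's theorem. -/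
theorem exists_norm_le_forall_abs_sub_le (Φ : StrongDual ℝ E →ₗ[ℝ] ℝ) {M η : ℝ}
    (hM : 0 < M) (hΦ : ∀ e, |Φ e| ≤ M * ‖e‖) (hη : 0 < η) (s : Finset (StrongDual ℝ E)) :
    ∃ x : E, ‖x‖ ≤ M ∧ ∀ e ∈ s, |e x - Φ e| ≤ η := by
  classical
  let A : E →L[ℝ] (s → ℝ) := ContinuousLinearMap.pi fun e => e.1
  let c : s → ℝ := fun e => Φ e.1
  by_cases hc : c ∈ closure (A '' Metric.closedBall 0 M)
  · obtain ⟨_, ⟨x, hx, rfl⟩, hd⟩ := Metric.mem_closure_iff.1 hc η hη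
    refine ⟨x, by simpa using hx, fun e he => ?_⟩
    have h := (dist_le_pi_dist c (A x) ⟨e, he⟩).trans hd.le
    rw [dist_comm, Real.dist_eq] at h
    exact h
  · exfalso
    have hconv : Convex ℝ (closure (A '' Metric.closedBall 0 M)) :=
      ((convex_closedBall (0 : E) M).linear_image A.toLinearMap).closure
    obtain ⟨f, u, hf, hu⟩ := geometric_hahn_banach_closed_point hconv isClosed_closure hc
    have hsum (a : s → ℝ) : f a = ∑ i, f (Pi.single i 1) * a i := by
      conv_lhs => rw [← Finset.univ_sum_single a]
      rw [map_sum]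
      refine Finset.sum_congr rfl fun i _ => ?_
      rw [mul_comm, ← smul_eq_mul, ← map_smul, ← Pi.single_smul, smul_eq_mul, mul_one]
    let e : StrongDual ℝ E := ∑ i : s, f (Pi.single i 1) • i.1
    have he (x : E) : e x = f (A x) := by
      rw [hsum]; simp [e, A]
    have hΦe : Φ e = f c := by
      rw [hsum]; simp [e, c]
    have hlt (x : E) (hx : ‖x‖ ≤ M) : e x < u := by
      rw [he]
      exact hf _ (subset_closure ⟨x, by simpa using hx, rfl⟩)
    have hu0 : 0 < u := by simpa using hlt 0 (by simpa using hM.le)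
    have hle (x : E) : e x ≤ u / M * ‖x‖ := by
      rcases eq_or_ne x 0 with rfl | hx
      · simp
      have hx' : 0 < ‖x‖ := norm_pos_iff.2 hx
      have h := hlt ((M / ‖x‖) • x) (by
        rw [norm_smul, Real.norm_of_nonneg (by positivity), div_mul_cancel₀ _ hx'.ne'])
      rw [map_smul, smul_eq_mul, div_mul_eq_mul_div, div_lt_iff₀ hx'] at h
      rw [div_mul_eq_mul_div, le_div_iff₀ hM]
      linarith
    have hnorm : ‖e‖ ≤ u / M := by
      refine e.opNorm_le_bound (by positivity) fun x => ?_
      rw [Real.norm_eq_abs, abs_le']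
      refine ⟨hle x, ?_⟩
      simpa using hle (-x)
    have h1 : Φ e ≤ M * ‖e‖ := (le_abs_self _).trans (hΦ e)
    have h2 : M * ‖e‖ ≤ u := by
      rw [le_div_iff₀ hM] at hnorm; linarith
    linarith

theorem exists_dual_eq_zero_eq_one_of_notMem {R : Submodule ℝ E} (hR : IsClosed (R : Set E))
    {x : E} (hx : x ∉ R) : ∃ f : StrongDual ℝ E, (∀ a ∈ R, f a = 0) ∧ f x = 1 := by
  obtain ⟨f, u, hf, hu⟩ := geometric_hahn_banach_closed_point R.convex hR hx
  have hf0 (a) (ha : a ∈ R) : f a = 0 := by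
    by_contra hne
    have h := hf ((u / f a) • a) (R.smul_mem _ ha)
    rw [map_smul, smul_eq_mul, div_mul_cancel₀ _ hne] at h
    exact lt_irrefl _ h
  have h0 : 0 < f x := by
    have := hf 0 R.zero_mem
    rw [map_zero] at this
    linarith
  exact ⟨(f x)⁻¹ • f, fun a ha => by simp [hf0 a ha], by simp [h0.ne']⟩

/-- James's criterion: a nonreflexive space carries an almost triangular biorthogonal system. -/
theorem exists_triangular_system_of_not_reflexive [CompleteSpace E]
    (h : ¬ Function.Surjective (NormedSpace.inclusionInDoubleDual ℝ E)) {η : ℝ} (hη : 0 < η) :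
    ∃ M : ℝ, 1 ≤ M ∧ ∃ (z : ℕ → E) (f : ℕ → StrongDual ℝ E),
      (∀ i, ‖z i‖ ≤ M) ∧ (∀ i, ‖f i‖ ≤ M) ∧ (∀ i j, i < j → |f j (z i)| ≤ η) ∧
      ∀ i j, j ≤ i → |f j (z i) - 1| ≤ η := by
  simp only [Function.Surjective, not_forall, not_exists] at h
  obtain ⟨Φ, hΦ⟩ := h
  let J := NormedSpace.inclusionInDoubleDualLi (𝕜 := ℝ) (E := E)
  let R : Submodule ℝ (StrongDual ℝ (StrongDual ℝ E)) := LinearMap.range J.toLinearMap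
  have hR : IsClosed (R : Set (StrongDual ℝ (StrongDual ℝ E))) := by
    exact (J.isometry.isUniformInducing.isComplete_range).isClosed
  have hΦR : Φ ∉ R := by
    rintro ⟨x, hx⟩
    exact hΦ x hx
  obtain ⟨Ψ, hΨR, hΨΦ⟩ :=
    exists_dual_eq_zero_eq_one_of_notMem (E := StrongDual ℝ (StrongDual ℝ E)) hR hΦR
  obtain ⟨K, -, hK⟩ : ∃ K : ℝ, 0 < K ∧ ∀ e, ‖Ψ e‖ ≤ K * ‖e‖ := Ψ.bound
  let M := max 1 (max ‖Φ‖ K)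
  have hM1 : 1 ≤ M := le_max_left _ _
  have hM0 : 0 < M := by linarith
  have hMΦ (e) : |Φ e| ≤ M * ‖e‖ :=
    (Φ.le_opNorm e).trans (by gcongr; exact (le_max_left _ _).trans (le_max_right _ _))
  have hMΨ (e) : |Ψ e| ≤ M * ‖e‖ :=
    (hK e).trans (by gcongr; exact (le_max_right _ _).trans (le_max_right _ _))
  classical
  let P : E × StrongDual ℝ E → Prop := fun p =>
    ‖p.1‖ ≤ M ∧ ‖p.2‖ ≤ M ∧ |Φ p.2 - 1| ≤ η / 2 ∧ |p.2 p.1 - 1| ≤ η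
  let r : E × StrongDual ℝ E → E × StrongDual ℝ E → Prop := fun p q =>
    |q.2 p.1| ≤ η ∧ |p.2 q.1 - 1| ≤ η
  obtain ⟨p, hp, hr⟩ := exists_seq_of_forall_finset_exists P r fun s hs => by
    obtain ⟨g, hg, hgs⟩ := exists_norm_le_forall_abs_sub_le Ψ.toLinearMap hM0 hMΨ (half_pos hη)
      (insert Φ (s.image fun p => NormedSpace.inclusionInDoubleDual ℝ E p.1))
    have hgΦ : |Φ g - 1| ≤ η / 2 := hΨΦ ▸ hgs Φ (Finset.mem_insert_self _ _)
    obtain ⟨x, hx, hxs⟩ := exists_norm_le_forall_abs_sub_le Φ.toLinearMap hM0 hMΦ (half_pos hη)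
      (insert g (s.image Prod.snd))
    have key (e : StrongDual ℝ E) (he : e ∈ insert g (s.image Prod.snd))
        (heΦ : |Φ e - 1| ≤ η / 2) : |e x - 1| ≤ η := by
      have := abs_sub_le (e x) (Φ e) 1
      have h' : |e x - Φ e| ≤ η / 2 := hxs e he
      linarith
    refine ⟨(x, g), ⟨hx, hg, hgΦ, key g (Finset.mem_insert_self _ _) hgΦ⟩, fun q hq => ⟨?_, ?_⟩⟩
    · have := hgs _ (Finset.mem_insert_of_mem (Finset.mem_image_of_mem _ hq))
      have h0 : Ψ (NormedSpace.inclusionInDoubleDual ℝ E q.1) = 0 := hΨR _ ⟨q.1, rfl⟩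
      change |g q.1 - Ψ (NormedSpace.inclusionInDoubleDual ℝ E q.1)| ≤ _ at this
      rw [h0, sub_zero] at this
      change |g q.1| ≤ η
      linarith
    · exact key q.2 (Finset.mem_insert_of_mem (Finset.mem_image_of_mem _ hq)) (hs q hq).2.2.1
  refine ⟨M, hM1, fun i => (p i).1, fun i => (p i).2, fun i => (hp i).1, fun i => (hp i).2.1,
    fun i j hij => (hr i j hij).1, fun i j hij => ?_⟩
  rcases hij.lt_or_eq with hlt | rfl
  · exact (hr j i hlt).2
  · exact (hp j).2.2.2

end Goldstine

section TreeEmbedding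

variable {E : Type*} [NormedAddCommGroup E]

/-- The sum of `z` along the branch leading to a vertex, where the vertices of the tree of depth
`n` are numbered in order (left subtree, root, right subtree) by the integers strictly between
`k` and `k + 2 ^ (n + 1)`. -/
def branchSum (z : ℕ → E) : ℕ → ℕ → List Bool → E
  | k, n, [] => z (k + 2 ^ n)
  | k, n, b :: s => z (k + 2 ^ n) + branchSum z (k + if b then 2 ^ n else 0) (n - 1) s

theorem norm_branchSum_le {z : ℕ → E} {M : ℝ} (hz : ∀ i, ‖z i‖ ≤ M) :
    ∀ (s : List Bool) (k n : ℕ), ‖branchSum z k n s‖ ≤ M * (s.length + 1)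
  | [], k, n => by simpa [branchSum] using hz _
  | b :: s, k, n => by
    have h1 := hz (k + 2 ^ n)
    have h2 := norm_branchSum_le hz s (k + if b then 2 ^ n else 0) (n - 1)
    rw [branchSum, List.length_cons]
    refine (norm_add_le _ _).trans ?_
    push_cast
    linarith

variable [NormedSpace ℝ E]

theorem abs_apply_branchSum_sub_le {z : ℕ → E} {f : StrongDual ℝ E} {c η : ℝ} :
    ∀ {s : List Bool} {k n : ℕ}, s.length ≤ n →
      (∀ i, k < i → i < k + 2 ^ (n + 1) → |f (z i) - c| ≤ η) →
      |f (branchSum z k n s) - (s.length + 1) * c| ≤ (s.length + 1) * η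
  | [], k, n, _, h => by
    have := h (k + 2 ^ n) (by simp) (by rw [pow_succ]; have := Nat.pow_pos (n := n) two_pos; omega)
    simpa [branchSum] using this
  | b :: s, k, n, hs, h => by
    obtain ⟨n, rfl⟩ : ∃ m, n = m + 1 := ⟨n - 1, by simp at hs; omega⟩
    have hpos : 0 < 2 ^ n := Nat.pow_pos (n := n) two_pos
    have h1 := h (k + 2 ^ (n + 1)) (by simp) (by rw [pow_succ _ (n + 1)]; omega)
    have h2 := abs_apply_branchSum_sub_le (s := s) (k := k + if b then 2 ^ (n + 1) else 0) (n := n)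
      (by simpa using hs) fun i hi hi' => h i (by omega) (by
        rw [pow_succ _ (n + 1)]; split_ifs at hi' <;> omega)
    rw [branchSum, map_add, List.length_cons, Nat.add_sub_cancel]
    rw [abs_le] at *
    push_cast
    constructor <;> nlinarith

theorem lcp_comm : ∀ s t, lcp s t = lcp t s
  | [], [] => rfl
  | [], _ :: _ => rfl
  | _ :: _, [] => rfl
  | a :: s, b :: t => by
    simp only [lcp, lcp_comm s t, eq_comm (a := a)]

theorem treeDist_comm (s t : List Bool) : treeDist s t = treeDist t s := by
  rw [treeDist, treeDist, lcp_comm]; ring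

theorem treeDist_cons_self (b : Bool) (s t : List Bool) :
    treeDist (b :: s) (b :: t) = treeDist s t := by
  simp [treeDist, lcp]; ring

variable {z : ℕ → E} {f : ℕ → StrongDual ℝ E} {M : ℝ}

/-- Two branches leaving a vertex in different directions have well separated sums. -/
theorem le_norm_branchSum_sub_branchSum (hf : ∀ i, ‖f i‖ ≤ M)
    (hlt : ∀ i j, i < j → |f j (z i)| ≤ 1 / 8) (hle : ∀ i j, j ≤ i → |f j (z i) - 1| ≤ 1 / 8)
    {s t : List Bool} {k n : ℕ} (hs : s.length ≤ n) (ht : t.length ≤ n) :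
    (s.length + 1 + (t.length + 1) : ℝ) ≤
      6 * M * ‖branchSum z k n s - branchSum z (k + 2 ^ (n + 1)) n t‖ := by
  set x := branchSum z k n s
  set y := branchSum z (k + 2 ^ (n + 1)) n t
  have h1 : |f k x - (s.length + 1) * 1| ≤ (s.length + 1) * (1 / 8) :=
    abs_apply_branchSum_sub_le hs fun i hi _ => hle i k hi.le
  have h2 : |f k y - (t.length + 1) * 1| ≤ (t.length + 1) * (1 / 8) :=
    abs_apply_branchSum_sub_le ht fun i hi _ => hle i k (by omega)
  have h3 : |f (k + 2 ^ (n + 1)) x - (s.length + 1) * 0| ≤ (s.length + 1) * (1 / 8) :=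
    abs_apply_branchSum_sub_le hs fun i _ hi => by simpa using hlt i _ hi
  have h4 : |f (k + 2 ^ (n + 1)) y - (t.length + 1) * 1| ≤ (t.length + 1) * (1 / 8) :=
    abs_apply_branchSum_sub_le ht fun i hi _ => hle i _ hi.le
  have h5 (j : ℕ) : |f j (x - y)| ≤ M * ‖x - y‖ :=
    ((f j).le_opNorm _).trans (by gcongr; exact hf j)
  have h6 := h5 k
  have h7 := h5 (k + 2 ^ (n + 1))
  rw [map_sub] at h6 h7
  rw [abs_le] at *
  linarith

theorem branchSum_bilipschitz (hz : ∀ i, ‖z i‖ ≤ M) (hf : ∀ i, ‖f i‖ ≤ M)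
    (hlt : ∀ i j, i < j → |f j (z i)| ≤ 1 / 8) (hle : ∀ i j, j ≤ i → |f j (z i) - 1| ≤ 1 / 8) :
    ∀ {s t : List Bool} {k n : ℕ}, s.length ≤ n → t.length ≤ n →
      treeDist s t ≤ 6 * M * ‖branchSum z k n s - branchSum z k n t‖ ∧
        ‖branchSum z k n s - branchSum z k n t‖ ≤ M * treeDist s t := by
  have nil_cons (b : Bool) (t : List Bool) (k n : ℕ) (ht : t.length + 1 ≤ n) :
      treeDist [] (b :: t) ≤ 6 * M * ‖branchSum z k n [] - branchSum z k n (b :: t)‖ ∧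
        ‖branchSum z k n [] - branchSum z k n (b :: t)‖ ≤ M * treeDist [] (b :: t) := by
    have hd : treeDist [] (b :: t) = t.length + 1 := by simp [treeDist, lcp]
    rw [hd, branchSum, branchSum, sub_add_cancel_left, norm_neg]
    refine ⟨?_, norm_branchSum_le hz _ _ _⟩
    set y := branchSum z (k + if b then 2 ^ n else 0) (n - 1) t
    have h2 : |f k y - (t.length + 1) * 1| ≤ (t.length + 1) * (1 / 8) :=
      abs_apply_branchSum_sub_le (by omega) fun i hi _ => hle i k (by omega)
    have h5 : |f k y| ≤ M * ‖y‖ :=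
      ((f k).le_opNorm _).trans (by gcongr; exact hf k)
    rw [abs_le] at *
    linarith
  have false_true (s t : List Bool) (k n : ℕ) (hs : s.length + 1 ≤ n) (ht : t.length + 1 ≤ n) :
      treeDist (false :: s) (true :: t) ≤
          6 * M * ‖branchSum z k n (false :: s) - branchSum z k n (true :: t)‖ ∧
        ‖branchSum z k n (false :: s) - branchSum z k n (true :: t)‖ ≤
          M * treeDist (false :: s) (true :: t) := by
    obtain ⟨n, rfl⟩ : ∃ m, n = m + 1 := ⟨n - 1, by omega⟩
    have hd : treeDist (false :: s) (true :: t) = s.length + 1 + (t.length + 1) := by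
      simp [treeDist, lcp]
    rw [hd, branchSum, branchSum, add_sub_add_left_eq_sub]
    simp only [Bool.false_eq_true, if_false, if_true, add_zero, Nat.add_sub_cancel]
    refine ⟨le_norm_branchSum_sub_branchSum hf hlt hle (by omega) (by omega), ?_⟩
    refine (norm_sub_le _ _).trans ?_
    rw [mul_add]
    exact add_le_add (norm_branchSum_le hz _ _ _) (norm_branchSum_le hz _ _ _)
  intro s
  induction s with
  | nil =>
    intro t k n _ ht
    cases t with
    | nil => simp [treeDist, lcp]
    | cons b t => exact nil_cons b t k n (by simpa using ht)
  | cons a s ih =>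
    intro t k n hs ht
    cases t with
    | nil =>
      rw [treeDist_comm, norm_sub_rev]
      exact nil_cons a s k n (by simpa using hs)
    | cons b t =>
      rw [List.length_cons] at hs ht
      rcases eq_or_ne a b with rfl | hab
      · rw [treeDist_cons_self, branchSum, branchSum, add_sub_add_left_eq_sub]
        exact ih (by omega) (by omega)
      · cases a <;> cases b
        · exact absurd rfl hab
        · exact false_true s t k n hs ht
        · rw [treeDist_comm, norm_sub_rev]
          exact false_true t s k n ht hs
        · exact absurd rfl hab

end TreeEmbedding

/-- The uniform embeddability of binary trees in a space which is not superreflexive. -/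
theorem exists_tree_embeddings_of_not_superReflexive {X : Type} [NormedAddCommGroup X]
    [NormedSpace ℝ X] (h : ¬ SuperReflexive X) :
    ∃ C : ℝ, 1 ≤ C ∧ ∀ n : ℕ, ∃ r : ℝ, 0 < r ∧ ∃ f : BinTree n → X,
      ∀ u v : BinTree n,
        r * treeDist u.1 v.1 ≤ ‖f u - f v‖ ∧ ‖f u - f v‖ ≤ r * C * treeDist u.1 v.1 := by
  simp only [SuperReflexive, not_forall] at h
  obtain ⟨Z, _, _, _, hfr, hZ⟩ := h
  obtain ⟨M, hM, z, f, hz, hf, hlt, hle⟩ :=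
    exists_triangular_system_of_not_reflexive hZ (η := 1 / 8) (by norm_num)
  refine ⟨12 * M ^ 2, by nlinarith, fun n => ?_⟩
  have : Finite (BinTree n) := (List.finite_length_le Bool n).to_subtype
  let g : BinTree n → Z := fun u => branchSum z 0 n u.1
  let F := Submodule.span ℝ (Set.range g)
  have hF : FiniteDimensional ℝ F := FiniteDimensional.span_of_finite ℝ (Set.finite_range g)
  obtain ⟨G, _, T, hT⟩ := hfr 1 one_pos F hF
  let g' : BinTree n → F := fun u => ⟨g u, Submodule.subset_span ⟨u, rfl⟩⟩
  set a := ‖(T : F →L[ℝ] G)‖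
  set b := ‖(T.symm : G →L[ℝ] F)‖
  have ha (v : F) : ‖T v‖ ≤ a * ‖v‖ := (T : F →L[ℝ] G).le_opNorm v
  have hb (v : F) : ‖v‖ ≤ b * ‖T v‖ := by
    simpa using (T.symm : G →L[ℝ] F).le_opNorm (T v)
  have hb0 : 0 < b := by
    refine (norm_nonneg (T.symm : G →L[ℝ] F)).lt_of_ne fun hb0 => ?_
    have h1 := hb (g' ⟨[], by simp⟩)
    rw [show b = 0 from hb0.symm, zero_mul, norm_le_zero_iff] at h1
    have h2 : z (0 + 2 ^ n) = 0 := congrArg Subtype.val h1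
    have h3 := hle (0 + 2 ^ n) 0 (Nat.zero_le _)
    rw [h2, map_zero] at h3
    norm_num at h3
  refine ⟨1 / (6 * M * b), by positivity, fun u => T (g' u), fun u v => ?_⟩
  obtain ⟨h1, h2⟩ := branchSum_bilipschitz hz hf hlt hle (k := 0) u.2 v.2
  have hn : ‖(T (g' u) : X) - T (g' v)‖ = ‖T (g' u - g' v)‖ := by
    rw [map_sub]; rfl
  have hn' : ‖branchSum z 0 n u.1 - branchSum z 0 n v.1‖ = ‖g' u - g' v‖ := rfl
  rw [hn]
  rw [hn'] at h1 h2
  have hD : 0 ≤ treeDist u.1 v.1 := by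
    have := (norm_nonneg _).trans h2
    exact nonneg_of_mul_nonneg_right this (by linarith)
  constructor
  · rw [one_div, inv_mul_le_iff₀ (by positivity)]
    calc treeDist u.1 v.1 ≤ 6 * M * ‖g' u - g' v‖ := h1
      _ ≤ 6 * M * (b * ‖T (g' u - g' v)‖) := by gcongr; exact hb _
      _ = _ := by ring
  · calc ‖T (g' u - g' v)‖ ≤ a * ‖g' u - g' v‖ := ha _
      _ ≤ a * (M * treeDist u.1 v.1) := by gcongr
      _ = (a * b) * (M * treeDist u.1 v.1 / b) := by field_simp
      _ ≤ (1 + 1) * (M * treeDist u.1 v.1 / b) := by gcongr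
      _ = _ := by field_simp; ring

section RadonNikodym

open MeasureTheory Filter Topology

variable {W : Type*} [NormedAddCommGroup W] [NormedSpace ℝ W]

theorem exists_seq_dual_separating [TopologicalSpace.SeparableSpace W] :
    ∃ φ : ℕ → StrongDual ℝ W, ∀ w, (∀ k, φ k w = 0) → w = 0 := by
  have hd := TopologicalSpace.denseRange_denseSeq W
  choose φ hφ1 hφ using fun k => exists_dual_vector'' ℝ (TopologicalSpace.denseSeq W k)
  refine ⟨φ, fun w hw => ?_⟩
  by_contra hne
  have hpos : 0 < ‖w‖ := norm_pos_iff.2 hne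
  obtain ⟨k, hk⟩ := hd.exists_dist_lt w (half_pos hpos)
  set y := TopologicalSpace.denseSeq W k
  have h1 : ‖y‖ ≤ ‖w - y‖ := by
    have h2 := (φ k).le_of_opNorm_le (hφ1 k) (w - y)
    rw [map_sub, hw, hφ, zero_sub, norm_neg, one_mul] at h2
    simpa using h2
  have h3 : ‖w‖ ≤ ‖w - y‖ + ‖y‖ := by simpa using norm_add_le (w - y) y
  rw [dist_eq_norm] at hk
  linarith

/-- In a reflexive space bounded sequences converge weakly along ultrafilters. -/
theorem exists_weak_limit_of_bounded
    (hW : Function.Surjective (NormedSpace.inclusionInDoubleDual ℝ W)) {ι : Type*}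
    (U : Ultrafilter ι) (x : ι → W) {K : ℝ} (hx : ∀ i, ‖x i‖ ≤ K) :
    ∃ w, ‖w‖ ≤ K ∧ ∀ φ : StrongDual ℝ W, Tendsto (fun i => φ (x i)) U (𝓝 (φ w)) := by
  have hbd (φ : StrongDual ℝ W) (i) : ‖φ (x i)‖ ≤ K * ‖φ‖ := by
    rw [mul_comm]
    exact φ.le_opNorm_of_le (hx i)
  have hlim (φ : StrongDual ℝ W) : ∃ a : ℝ, Tendsto (fun i => φ (x i)) U (𝓝 a) := by
    have hle : ((U.map fun i => φ (x i) : Ultrafilter ℝ) : Filter ℝ) ≤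
        𝓟 (Metric.closedBall 0 (K * ‖φ‖)) := by
      rw [le_principal_iff, Ultrafilter.mem_coe, Ultrafilter.mem_map]
      exact Filter.univ_mem' fun i => by simpa using hbd φ i
    obtain ⟨a, -, ha⟩ := (isCompact_closedBall (0 : ℝ) (K * ‖φ‖)).ultrafilter_le_nhds _ hle
    exact ⟨a, ha⟩
  choose L hL using hlim
  let Φ : StrongDual ℝ W →ₗ[ℝ] ℝ :=
    { toFun := L
      map_add' := fun φ ψ => tendsto_nhds_unique (hL (φ + ψ)) ((hL φ).add (hL ψ))
      map_smul' := fun c φ => tendsto_nhds_unique (hL (c • φ)) ((hL φ).const_mul c) }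
  have hΦ (φ) : ‖Φ φ‖ ≤ K * ‖φ‖ :=
    le_of_tendsto (hL φ).norm (Filter.Eventually.of_forall (hbd φ))
  obtain ⟨w, hw⟩ := hW (Φ.mkContinuous K hΦ)
  have hwφ (φ : StrongDual ℝ W) : φ w = L φ := by
    rw [← NormedSpace.dual_def, hw]; rfl
  refine ⟨w, ?_, fun φ => hwφ φ ▸ hL φ⟩
  obtain ⟨φ, hφ1, hφ⟩ := exists_dual_vector'' ℝ w
  obtain ⟨i⟩ : Nonempty ι := nonempty_of_neBot (U : Filter ι)
  have hK : 0 ≤ K := (norm_nonneg _).trans (hx i)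
  have : φ w ≤ K * ‖φ‖ := by rw [hwφ]; exact (le_abs_self _).trans (hΦ φ)
  rw [hφ] at this
  simp only [RCLike.ofReal_real_eq_id, id_eq] at this
  nlinarith

/-- Separable reflexive spaces have the Radon–Nikodým property. -/
theorem LipschitzWith.ae_exists_hasDerivAt_of_reflexive [CompleteSpace W]
    [TopologicalSpace.SeparableSpace W]
    (hW : Function.Surjective (NormedSpace.inclusionInDoubleDual ℝ W)) {K : NNReal} {g : ℝ → W}
    (hg : LipschitzWith K g) : ∀ᵐ t, ∃ g', HasDerivAt g g' t := by
  have hφg (φ : StrongDual ℝ W) : LipschitzWith (‖φ‖₊ * K) (φ ∘ g) := φ.lipschitz.comp hg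
  let q : ℝ → ℕ → W := fun t n => ((n : ℝ) + 1) • (g (t + 1 / ((n : ℝ) + 1)) - g t)
  have hq (t : ℝ) (n : ℕ) : ‖q t n‖ ≤ K := by
    have h := hg.dist_le_mul (t + 1 / ((n : ℝ) + 1)) t
    rw [dist_eq_norm, Real.dist_eq, add_sub_cancel_left, abs_of_pos (by positivity)] at h
    rw [norm_smul, Real.norm_of_nonneg (by positivity)]
    calc ((n : ℝ) + 1) * ‖g (t + 1 / ((n : ℝ) + 1)) - g t‖
        ≤ ((n : ℝ) + 1) * (K * (1 / ((n : ℝ) + 1))) := by gcongr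
      _ = K := by field_simp
  choose G hGK hG using fun t => exists_weak_limit_of_bounded hW (hyperfilter ℕ) (q t) (hq t)
  have hderiv (φ : StrongDual ℝ W) : ∀ᵐ t, deriv (φ ∘ g) t = φ (G t) := by
    filter_upwards [(hφg φ).ae_differentiableAt_real] with t ht
    refine tendsto_nhds_unique ?_ (hG t φ)
    have h1 : Tendsto (fun n : ℕ => (1 : ℝ) / ((n : ℝ) + 1)) (hyperfilter ℕ : Filter ℕ)
        (𝓝[≠] 0) := by
      refine tendsto_nhdsWithin_iff.2 ⟨tendsto_one_div_add_atTop_nhds_zero_nat.mono_left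
        Nat.hyperfilter_le_atTop, Filter.Eventually.of_forall fun n => ?_⟩
      simp only [Set.mem_compl_iff, Set.mem_singleton_iff]
      positivity
    refine (ht.hasDerivAt.tendsto_slope_zero.comp h1).congr fun n => ?_
    simp [q]
  obtain ⟨ψ, hψ⟩ := exists_seq_dual_separating (W := W)
  borelize W
  have := UniformSpace.secondCountable_of_separable W
  have hmeas : AEMeasurable G := by
    let A : W →L[ℝ] (ℕ → ℝ) := ContinuousLinearMap.pi ψ
    have hA : Function.Injective A := (injective_iff_map_eq_zero A).2 fun w hw =>
      hψ w fun k => congrFun hw k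
    have hAe : MeasurableEmbedding A := A.continuous.measurableEmbedding hA
    rw [← hAe.aemeasurable_comp_iff, aemeasurable_pi_iff]
    intro k
    exact (measurable_deriv (ψ k ∘ g)).aemeasurable.congr (hderiv (ψ k))
  have hloc : LocallyIntegrable G := by
    refine (locallyIntegrable_const (K : ℝ)).mono hmeas.aestronglyMeasurable ?_
    exact Filter.Eventually.of_forall fun t => (hGK t).trans (le_abs_self _)
  have hint (b : ℝ) : ∫ t in (0 : ℝ)..b, G t = g b - g 0 := by
    refine (SeparatingDual.eq_iff_forall_dual_eq (R := ℝ)).2 fun φ => ?_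
    have hi : IntervalIntegrable G volume 0 b := intervalIntegrable_iff.2 <|
      (hloc.integrableOn_isCompact isCompact_uIcc).mono_set Set.uIoc_subset_uIcc
    rw [← φ.intervalIntegral_comp_comm hi, map_sub]
    refine .trans ?_
      ((hφg φ).lipschitzOnWith.absolutelyContinuousOnInterval).integral_deriv_eq_sub
    exact intervalIntegral.integral_congr_ae ((hderiv φ).mono fun t ht _ => ht.symm)
  filter_upwards [LocallyIntegrable.ae_hasDerivAt_integral hloc] with t ht
  refine ⟨G t, ?_⟩
  have := ht 0
  simp only [hint] at this
  simpa using this.add_const (g 0)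

/-- At a point of differentiability the second differences over the dyadic intervals around it
are small compared with the length of these intervals. -/
theorem not_hasDerivAt_of_dyadic_second_difference {g : ℝ → W} {δ : ℝ} (hδ : 0 < δ)
    (hg : ∀ n k : ℕ, k < 2 ^ n → δ / 2 ^ n ≤
      ‖g ((2 * k) / 2 ^ (n + 1)) + g ((2 * k + 2) / 2 ^ (n + 1)) -
        (2 : ℝ) • g ((2 * k + 1) / 2 ^ (n + 1))‖)
    {t : ℝ} (ht0 : 0 ≤ t) (ht1 : t < 1) (g' : W) : ¬ HasDerivAt g g' t := by
  intro h
  rw [hasDerivAt_iff_isLittleO] at h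
  have h2 := h.def (c := δ / 8) (by positivity)
  obtain ⟨η, hη, hball⟩ := Metric.eventually_nhds_iff.1 h2
  obtain ⟨n, hn⟩ := exists_pow_lt_of_lt_one hη (by norm_num : (1 / 2 : ℝ) < 1)
  rw [one_div, inv_pow] at hn
  have hp : (0 : ℝ) < 2 ^ n := by positivity
  set k := ⌊t * 2 ^ n⌋₊
  have hk1 : (k : ℝ) ≤ t * 2 ^ n := Nat.floor_le (by positivity)
  have hk2 : t * 2 ^ n < k + 1 := Nat.lt_floor_add_one _
  have hk : k < 2 ^ n := by
    have : (k : ℝ) < 2 ^ n := hk1.trans_lt (by nlinarith)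
    exact_mod_cast this
  have hsmall (s : ℝ) (hs0 : (2 * k) / 2 ^ (n + 1) ≤ s) (hs1 : s ≤ (2 * k + 2) / 2 ^ (n + 1)) :
      ‖g s - g t - (s - t) • g'‖ ≤ δ / 8 * (2 ^ n)⁻¹ := by
    have e0 : (2 * k : ℝ) / 2 ^ (n + 1) = k * (2 ^ n)⁻¹ := by rw [pow_succ]; field_simp
    have e1 : (2 * k + 2 : ℝ) / 2 ^ (n + 1) = (k + 1) * (2 ^ n)⁻¹ := by rw [pow_succ]; field_simp
    rw [e0] at hs0
    rw [e1] at hs1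
    have ht2 : k * (2 ^ n)⁻¹ ≤ t := by rwa [← div_eq_mul_inv, div_le_iff₀ hp]
    have ht3 : t ≤ (k + 1) * (2 ^ n)⁻¹ := by rw [← div_eq_mul_inv, le_div_iff₀ hp]; exact hk2.le
    have hst : |s - t| ≤ (2 ^ n)⁻¹ := by
      rw [abs_le]; constructor <;> linarith
    have := hball (y := s) (by rw [Real.dist_eq]; linarith)
    refine this.trans ?_
    rw [Real.norm_eq_abs]
    gcongr
  have hp' : (0 : ℝ) < 2 ^ (n + 1) := by positivity
  have ha := hsmall ((2 * k) / 2 ^ (n + 1)) le_rfl (by gcongr; linarith)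
  have hb := hsmall ((2 * k + 2) / 2 ^ (n + 1)) (by gcongr; linarith) le_rfl
  have hc := hsmall ((2 * k + 1) / 2 ^ (n + 1)) (by gcongr; linarith) (by gcongr; linarith)
  set a : ℝ := (2 * k) / 2 ^ (n + 1) with ha'
  set b : ℝ := (2 * k + 2) / 2 ^ (n + 1) with hb'
  set c : ℝ := (2 * k + 1) / 2 ^ (n + 1) with hc'
  have hab : a + b = 2 * c := by rw [ha', hb', hc']; field_simp; ring
  have heq : g a + g b - (2 : ℝ) • g c = (g a - g t - (a - t) • g') + (g b - g t - (b - t) • g') -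
      (2 : ℝ) • (g c - g t - (c - t) • g') := by
    have : b = 2 * c - a := by linarith
    rw [this]
    module
  have hd := hg n k hk
  rw [heq] at hd
  have h3 := norm_sub_le ((g a - g t - (a - t) • g') + (g b - g t - (b - t) • g'))
    ((2 : ℝ) • (g c - g t - (c - t) • g'))
  have h4 := norm_add_le (g a - g t - (a - t) • g') (g b - g t - (b - t) • g')
  rw [norm_smul, Real.norm_of_nonneg zero_le_two] at h3
  rw [div_eq_mul_inv] at hd
  have : 0 < δ * (2 ^ n)⁻¹ := by positivity
  linarith

end RadonNikodym

section FiniteRepresentability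

open Filter Topology

theorem finitelyRepresentable_of_forall_exists_almost_isometry {Y X : Type}
    [NormedAddCommGroup Y] [NormedSpace ℝ Y] [NormedAddCommGroup X] [NormedSpace ℝ X]
    (h : ∀ η : ℝ, 0 < η → ∀ F : Submodule ℝ Y, FiniteDimensional ℝ F →
      ∃ T : F →ₗ[ℝ] X, ∀ v, (1 - η) * ‖v‖ ≤ ‖T v‖ ∧ ‖T v‖ ≤ (1 + η) * ‖v‖) :
    FinitelyRepresentable Y X := by
  intro ε hε F hF
  obtain ⟨T, hT⟩ := h (ε / (2 + ε)) (by positivity) F hF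
  have e1 : 1 - ε / (2 + ε) = 2 / (2 + ε) := by field_simp; ring
  have e2 : 1 + ε / (2 + ε) = (1 + ε) * (2 / (2 + ε)) := by field_simp; ring
  rw [e1, e2] at hT
  have hpos : 0 < 2 / (2 + ε) := by positivity
  have hinj : Function.Injective T := (injective_iff_map_eq_zero T).2 fun v hv => by
    have := (hT v).1
    rw [hv, norm_zero] at this
    exact norm_le_zero_iff.1 (by nlinarith [norm_nonneg v])
  let S := (LinearEquiv.ofInjective T hinj).toContinuousLinearEquiv
  have hS (v : F) : ‖S v‖ = ‖T v‖ := rfl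
  refine ⟨LinearMap.range T, inferInstance, S, ?_⟩
  have h1 : ‖(S : F →L[ℝ] LinearMap.range T)‖ ≤ (1 + ε) * (2 / (2 + ε)) :=
    ContinuousLinearMap.opNorm_le_bound _ (by positivity) fun v => (hT v).2
  have h2 : ‖(S.symm : LinearMap.range T →L[ℝ] F)‖ ≤ (2 / (2 + ε))⁻¹ := by
    refine ContinuousLinearMap.opNorm_le_bound _ (by positivity) fun w => ?_
    rw [le_inv_mul_iff₀ hpos]
    have := (hT (S.symm w)).1
    rwa [← hS, S.apply_symm_apply] at this
  calc _ ≤ (1 + ε) * (2 / (2 + ε)) * (2 / (2 + ε))⁻¹ := by gcongr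
    _ = 1 + ε := mul_inv_cancel_right₀ hpos.ne' _

end FiniteRepresentability

section Ultrapower

open Filter Topology

variable (X : Type) [NormedAddCommGroup X] [NormedSpace ℝ X] (U : Ultrafilter ℕ)

/-- The bounded sequences in `X` whose norms tend to zero along `U`. -/
def nullSequences : Submodule ℝ (lp (fun _ : ℕ => X) ⊤) where
  carrier := {x | Tendsto (fun m => ‖x m‖) U (𝓝 0)}
  zero_mem' := by simp
  add_mem' {x y} hx hy := by
    refine squeeze_zero (fun _ => norm_nonneg _) (fun m => norm_add_le (x m) (y m)) ?_
    simpa using hx.add hy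
  smul_mem' c x hx := by
    have : Tendsto (fun m => ‖c‖ * ‖x m‖) U (𝓝 0) := by simpa using hx.const_mul ‖c‖
    simpa [norm_smul] using this

instance isClosed_nullSequences :
    IsClosed (nullSequences X U : Set (lp (fun _ : ℕ => X) ⊤)) := by
  refine isClosed_of_closure_subset fun x hx => ?_
  refine Metric.tendsto_nhds.2 fun ε hε => ?_
  obtain ⟨y, hy, hxy⟩ := Metric.mem_closure_iff.1 hx (ε / 2) (half_pos hε)
  filter_upwards [Metric.tendsto_nhds.1 hy (ε / 2) (half_pos hε)] with m hm
  have h1 : ‖x m - y m‖ ≤ ‖x - y‖ := lp.norm_apply_le_norm ENNReal.top_ne_zero (x - y) m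
  have h2 : ‖x m‖ ≤ ‖x m - y m‖ + ‖y m‖ := by simpa using norm_add_le (x m - y m) (y m)
  rw [dist_eq_norm] at hxy
  simp only [dist_zero_right, norm_norm] at hm ⊢
  linarith

/-- The ultrapower of `X` along `U`. -/
abbrev Ultrapower : Type := lp (fun _ : ℕ => X) ⊤ ⧸ nullSequences X U

variable {X U}

theorem tendsto_norm_ultrapower_mk (x : lp (fun _ : ℕ => X) ⊤) :
    Tendsto (fun m => ‖x m‖) U (𝓝 ‖(Submodule.Quotient.mk x : Ultrapower X U)‖) := by
  obtain ⟨c, hc⟩ : ∃ c : ℝ, Tendsto (fun m => ‖x m‖) U (𝓝 c) := by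
    have hle : ((U.map fun m => ‖x m‖ : Ultrafilter ℝ) : Filter ℝ) ≤ 𝓟 (Set.Icc 0 ‖x‖) := by
      rw [le_principal_iff, Ultrafilter.mem_coe, Ultrafilter.mem_map]
      exact Filter.univ_mem' fun m =>
        ⟨norm_nonneg _, lp.norm_apply_le_norm ENNReal.top_ne_zero x m⟩
    obtain ⟨c, -, hc⟩ := isCompact_Icc.ultrafilter_le_nhds _ hle
    exact ⟨c, hc⟩
  have hc0 : 0 ≤ c := ge_of_tendsto' hc fun m => norm_nonneg _
  suffices ‖(Submodule.Quotient.mk x : Ultrapower X U)‖ = c by rwa [this]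
  refine le_antisymm (le_of_forall_pos_le_add fun ε hε => ?_) ?_
  · classical
    let s : Set ℕ := {m | ‖x m‖ ≤ c + ε}
    have hs : s ∈ U := hc.eventually (ge_mem_nhds (by linarith))
    have hy (m) : ‖s.indicator (fun m => x m) m‖ ≤ c + ε := by
      by_cases hm : m ∈ s
      · rw [Set.indicator_of_mem hm]; exact hm
      · simp only [hm, not_false_eq_true, Set.indicator_of_notMem, norm_zero]; linarith
    let y : lp (fun _ : ℕ => X) ⊤ := ⟨s.indicator fun m => x m, memℓp_infty
      ⟨c + ε, by rintro _ ⟨m, rfl⟩; exact hy m⟩⟩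
    have hxy : (Submodule.Quotient.mk x : Ultrapower X U) = Submodule.Quotient.mk y := by
      rw [Submodule.Quotient.eq]
      refine tendsto_const_nhds.congr' ?_
      filter_upwards [hs] with m hm
      have : (x - y : lp (fun _ : ℕ => X) ⊤) m = x m - s.indicator (fun m => x m) m := rfl
      simp [this, hm]
    rw [hxy]
    exact (Submodule.Quotient.norm_mk_le _ _).trans
      (lp.norm_le_of_forall_le (by linarith) hy)
  · refine le_of_forall_pos_le_add fun ε hε => ?_
    obtain ⟨y, hy, hyn⟩ := Submodule.Quotient.norm_mk_lt
      (Submodule.Quotient.mk x : Ultrapower X U) hε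
    have hN : y - x ∈ nullSequences X U := (Submodule.Quotient.eq _).1 hy
    have hlim : Tendsto (fun m => ‖x m‖ - ‖(y - x : lp (fun _ : ℕ => X) ⊤) m‖) U (𝓝 c) := by
      simpa using hc.sub hN
    refine le_of_tendsto' hlim fun m => ?_
    have h1 : ‖y m‖ ≤ ‖y‖ := lp.norm_apply_le_norm ENNReal.top_ne_zero y m
    have h2 : (y - x : lp (fun _ : ℕ => X) ⊤) m = y m - x m := rfl
    have h3 : ‖x m‖ ≤ ‖y m‖ + ‖y m - x m‖ := by simpa using norm_sub_le (y m) (y m - x m)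
    rw [h2]
    linarith

theorem finitelyRepresentable_of_linearIsometry_ultrapower {Y : Type} [NormedAddCommGroup Y]
    [NormedSpace ℝ Y] (J : Y →ₗᵢ[ℝ] Ultrapower X U) : FinitelyRepresentable Y X := by
  refine finitelyRepresentable_of_forall_exists_almost_isometry fun η hη F _ => ?_
  obtain ⟨L, hL⟩ := Module.projective_lifting_property (nullSequences X U).mkQ
    (J.toLinearMap ∘ₗ F.subtype) (Submodule.mkQ_surjective _)
  let L' : F →L[ℝ] lp (fun _ : ℕ => X) ⊤ := LinearMap.toContinuousLinearMap L
  have hlim (v : F) : Tendsto (fun m => ‖(L v) m‖) U (𝓝 ‖v‖) := by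
    have h1 : ‖(Submodule.Quotient.mk (L v) : Ultrapower X U)‖ = ‖v‖ := by
      have : (Submodule.Quotient.mk (L v) : Ultrapower X U) = J v := LinearMap.congr_fun hL v
      rw [this, J.norm_map]
      rfl
    exact h1 ▸ tendsto_norm_ultrapower_mk (L v)
  have hbd (v : F) (m : ℕ) : ‖(L v) m‖ ≤ ‖L'‖ * ‖v‖ :=
    (lp.norm_apply_le_norm ENNReal.top_ne_zero (L v) m).trans (L'.le_opNorm v)
  set ρ := η / (2 * (‖L'‖ + 1))
  have hρ : 0 < ρ := by positivity
  obtain ⟨t, hts, htf, ht⟩ := (isCompact_sphere (0 : F) 1).finite_cover_balls hρ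
  have hev : ∀ᶠ m in (U : Filter ℕ), ∀ v ∈ t, |‖(L v) m‖ - 1| < η / 2 := by
    refine (eventually_all_finite htf).2 fun v hv => ?_
    have h1 : ‖v‖ = 1 := by simpa using hts hv
    have := Metric.tendsto_nhds.1 (hlim v) (η / 2) (half_pos hη)
    rwa [h1] at this
  obtain ⟨m, hm⟩ := hev.exists
  let T : F →ₗ[ℝ] X :=
    { toFun := fun v => (L v) m
      map_add' := fun v w => by rw [map_add]; rfl
      map_smul' := fun c v => by rw [map_smul]; rfl }
  have hsphere (v : F) (hv : ‖v‖ = 1) : |‖T v‖ - 1| ≤ η := by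
    obtain ⟨w, hw, hvw⟩ : ∃ w ∈ t, dist v w < ρ := by
      simpa using ht (show v ∈ Metric.sphere (0 : F) 1 by simpa using hv)
    have h1 : |‖T w‖ - 1| < η / 2 := hm w hw
    have h2 : |‖T v‖ - ‖T w‖| ≤ η / 2 := by
      refine (abs_norm_sub_norm_le _ _).trans ?_
      rw [← map_sub]
      refine (hbd (v - w) m).trans ?_
      rw [← dist_eq_norm]
      calc ‖L'‖ * dist v w ≤ (‖L'‖ + 1) * ρ := by gcongr; linarith
        _ = η / 2 := by simp only [ρ]; field_simp
    have := abs_sub_le ‖T v‖ ‖T w‖ 1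
    linarith
  refine ⟨T, fun v => ?_⟩
  rcases eq_or_ne v 0 with rfl | hv
  · simp
  have hv' : 0 < ‖v‖ := norm_pos_iff.2 hv
  have h1 := hsphere (‖v‖⁻¹ • v) (by rw [norm_smul, norm_inv, norm_norm, inv_mul_cancel₀ hv'.ne'])
  rw [map_smul, norm_smul, norm_inv, norm_norm, abs_le] at h1
  constructor
  · rw [← le_div_iff₀ hv', div_eq_inv_mul]; linarith
  · rw [← div_le_iff₀ hv', div_eq_inv_mul]; linarith

end Ultrapower

section DyadicPaths

theorem lcp_append_left (p s t : List Bool) : lcp (p ++ s) (p ++ t) = p.length + lcp s t := by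
  induction p with
  | nil => simp
  | cons b p ih => simp [lcp, ih]; omega

theorem treeDist_append_left (p s t : List Bool) :
    treeDist (p ++ s) (p ++ t) = treeDist s t := by
  simp [treeDist, lcp_append_left]; ring

variable {X : Type*} [NormedAddCommGroup X] [NormedSpace ℝ X]

/-- The path in the binary tree which at each vertex `v` follows the direction `β v`. -/
def greedyPath (β : List Bool → Bool) : ℕ → List Bool
  | 0 => []
  | n + 1 => greedyPath β n ++ [β (greedyPath β n)]

theorem length_greedyPath (β : List Bool → Bool) (n : ℕ) : (greedyPath β n).length = n := by
  induction n with
  | zero => rfl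
  | succ n ih => simp [greedyPath, ih]

theorem greedyPath_prefix (β : List Bool → Bool) {m n : ℕ} (h : m ≤ n) :
    greedyPath β m <+: greedyPath β n := by
  induction n, h using Nat.le_induction with
  | base => exact List.prefix_rfl
  | succ n _ ih => exact ih.trans (List.prefix_append _ _)

/-- The images of vertices beyond the two children of `v` cannot both be close to the reflection
of `y` in the image of `v`. -/
theorem exists_direction_second_difference {F : List Bool → X} {N : ℕ} {c : ℝ}
    (hF : ∀ u v, u.length ≤ N → v.length ≤ N → c * treeDist u v ≤ ‖F u - F v‖)
    (v : List Bool) (j : ℕ) (y : X) :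
    ∃ b : Bool, ∀ w, w.length = v.length + j → w.length ≤ N → v ++ [b] <+: w →
      c * j ≤ ‖y + F w - (2 : ℝ) • F v‖ := by
  by_contra! h
  obtain ⟨_, h1, h1N, ⟨s, rfl⟩, hs⟩ := h false
  obtain ⟨_, h2, h2N, ⟨t, rfl⟩, ht⟩ := h true
  have h3 := hF _ _ h1N h2N
  rw [List.append_assoc, List.append_assoc] at h3
  simp only [List.length_append, List.length_cons, List.length_nil] at h1 h2
  have h4 : treeDist (v ++ ([false] ++ s)) (v ++ ([true] ++ t)) = 2 * j := by
    have e1 : (j : ℝ) = s.length + 1 := by exact_mod_cast (by omega : j = s.length + 1)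
    have e2 : (j : ℝ) = t.length + 1 := by exact_mod_cast (by omega : j = t.length + 1)
    rw [treeDist_append_left]
    simp only [treeDist, lcp, List.cons_append, List.nil_append, List.length_cons]
    push_cast
    simp
    linarith
  rw [h4] at h3
  rw [List.append_assoc] at hs ht
  have h5 := norm_sub_le (y + F (v ++ ([false] ++ s)) - (2 : ℝ) • F v)
    (y + F (v ++ ([true] ++ t)) - (2 : ℝ) • F v)
  rw [sub_sub_sub_cancel_right, add_sub_add_left_eq_sub] at h5
  linarith

theorem exists_path_second_difference {F : List Bool → X} {N : ℕ} {c : ℝ}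
    (hF : ∀ u v, u.length ≤ N → v.length ≤ N →
      c * treeDist u v ≤ ‖F u - F v‖ ∧ ‖F u - F v‖ ≤ treeDist u v) :
    ∃ x : ℕ → X, x 0 = 0 ∧ (∀ i < N, ‖x (i + 1) - x i‖ ≤ 1) ∧
      ∀ k q : ℕ, (2 * q + 2) * 2 ^ k ≤ N → c * 2 ^ k ≤
        ‖x (2 * q * 2 ^ k) + x ((2 * q + 2) * 2 ^ k) - (2 : ℝ) • x ((2 * q + 1) * 2 ^ k)‖ := by
  choose β hβ using fun v : List Bool => exists_direction_second_difference
    (fun u v hu hv => (hF u v hu hv).1) v (2 ^ padicValNat 2 v.length)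
    (F (v.take (v.length - 2 ^ padicValNat 2 v.length)))
  refine ⟨fun i => F (greedyPath β i) - F [], by simp [greedyPath], fun i hi => ?_,
    fun k q hq => ?_⟩
  · rw [sub_sub_sub_cancel_right]
    refine (hF _ _ (by rw [length_greedyPath]; omega) (by rw [length_greedyPath]; omega)).2.trans ?_
    have := treeDist_append_left (greedyPath β i) [β (greedyPath β i)] []
    rw [List.append_nil] at this
    rw [greedyPath, this]
    simp [treeDist, lcp]
  · have hp : 0 < 2 ^ k := by positivity
    set v := greedyPath β ((2 * q + 1) * 2 ^ k)
    have hlen : v.length = (2 * q + 1) * 2 ^ k := length_greedyPath _ _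
    have hval : padicValNat 2 v.length = k := by
      rw [hlen, padicValNat.mul (by omega) hp.ne', padicValNat.prime_pow,
        padicValNat.eq_zero_of_not_dvd (by omega), zero_add]
    have hpre : v.take (v.length - 2 ^ k) = greedyPath β (2 * q * 2 ^ k) := by
      have h1 : greedyPath β (2 * q * 2 ^ k) <+: v := greedyPath_prefix β (by gcongr; omega)
      rw [List.prefix_iff_eq_take.1 h1, hlen, length_greedyPath]
      congr 1
      rw [add_mul, one_mul, Nat.add_sub_cancel]
    have h := hβ v (greedyPath β ((2 * q + 2) * 2 ^ k))
    rw [hval, hpre, length_greedyPath, hlen] at h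
    have h' := h (by ring) hq (by
      have := greedyPath_prefix β (m := (2 * q + 1) * 2 ^ k + 1) (n := (2 * q + 2) * 2 ^ k)
        (by nlinarith)
      rwa [greedyPath] at this)
    push_cast at h'
    convert h' using 2
    module

end DyadicPaths

section Differentiation

open Filter Topology

theorem min_floor_sub_min_floor_le {s t : ℝ} (hst : s ≤ t) (N : ℕ) :
    ((min ⌊t * N⌋₊ N : ℕ) : ℝ) - (min ⌊s * N⌋₊ N : ℕ) ≤ (t - s) * N + 1 := by
  have h0 : 0 ≤ (t - s) * N := mul_nonneg (sub_nonneg.2 hst) N.cast_nonneg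
  push_cast
  rcases le_total (N : ℝ) ⌊s * N⌋₊ with hs | hs
  · rw [min_eq_right hs]
    linarith [min_le_right (⌊t * N⌋₊ : ℝ) N]
  · rw [min_eq_left hs]
    have h1 := Nat.lt_floor_add_one (s * N)
    rcases le_total 0 (t * N) with ht | ht
    · have := Nat.floor_le ht
      linarith [min_le_left (⌊t * N⌋₊ : ℝ) N]
    · rw [Nat.floor_of_nonpos ht]
      have : min (((0 : ℕ) : ℝ)) N ≤ 0 := by simp
      have : (0 : ℝ) ≤ ⌊s * N⌋₊ := Nat.cast_nonneg _
      linarith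

variable {X : Type} [NormedAddCommGroup X]

theorem norm_sub_le_of_forall_norm_succ_sub_le {x : ℕ → X} {N : ℕ}
    (hx : ∀ i < N, ‖x (i + 1) - x i‖ ≤ 1) {i j : ℕ} (hij : i ≤ j) (hj : j ≤ N) :
    ‖x j - x i‖ ≤ j - i := by
  induction j, hij using Nat.le_induction with
  | base => simp
  | succ j _ ih =>
    have h := norm_add_le (x (j + 1) - x j) (x j - x i)
    rw [sub_add_sub_cancel] at h
    push_cast
    linarith [hx j (by omega), ih (by omega)]

variable [NormedSpace ℝ X]

/-- The rescaled limit of longer and longer discrete paths is a Lipschitz function with large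
second differences over the dyadic intervals. -/
theorem exists_lipschitz_ultrapower {c : ℝ}
    (h : ∀ m : ℕ, ∃ x : ℕ → X, x 0 = 0 ∧ (∀ i < 2 ^ m, ‖x (i + 1) - x i‖ ≤ 1) ∧
      ∀ k q : ℕ, (2 * q + 2) * 2 ^ k ≤ 2 ^ m → c * 2 ^ k ≤
        ‖x (2 * q * 2 ^ k) + x ((2 * q + 2) * 2 ^ k) - (2 : ℝ) • x ((2 * q + 1) * 2 ^ k)‖) :
    ∃ g : ℝ → Ultrapower X (hyperfilter ℕ), LipschitzWith 1 g ∧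
      ∀ n k : ℕ, k < 2 ^ n → c / 2 / 2 ^ n ≤
        ‖g ((2 * k) / 2 ^ (n + 1)) + g ((2 * k + 2) / 2 ^ (n + 1)) -
          (2 : ℝ) • g ((2 * k + 1) / 2 ^ (n + 1))‖ := by
  choose x hx0 hx1 hx2 using h
  let e : ℕ → ℝ → ℕ := fun m t => min ⌊t * (2 ^ m : ℕ)⌋₊ (2 ^ m)
  have he (m t) : e m t ≤ 2 ^ m := min_le_right _ _
  let y : ℝ → ℕ → X := fun t m => ((2 : ℝ) ^ m)⁻¹ • x m (e m t)
  have hy (t m) : ‖y t m‖ ≤ 1 := by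
    have h1 := norm_sub_le_of_forall_norm_succ_sub_le (hx1 m) (Nat.zero_le _) (he m t)
    have h2 : (e m t : ℝ) ≤ 2 ^ m := by exact_mod_cast he m t
    rw [hx0, sub_zero, Nat.cast_zero, sub_zero] at h1
    rw [norm_smul, norm_inv, norm_pow, Real.norm_two, inv_mul_le_iff₀ (by positivity)]
    linarith
  let Y : ℝ → lp (fun _ : ℕ => X) ⊤ := fun t =>
    ⟨y t, memℓp_infty ⟨1, by rintro _ ⟨m, rfl⟩; exact hy t m⟩⟩
  let g : ℝ → Ultrapower X (hyperfilter ℕ) := fun t => Submodule.Quotient.mk (Y t)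
  have hlip (s t : ℝ) (hst : s ≤ t) : ‖g t - g s‖ ≤ t - s := by
    have h1 := tendsto_norm_ultrapower_mk (U := hyperfilter ℕ) (Y t - Y s)
    have h2 : Tendsto (fun m : ℕ => (t - s) + (1 / 2 : ℝ) ^ m) (hyperfilter ℕ : Filter ℕ)
        (𝓝 (t - s)) := by
      have := (tendsto_pow_atTop_nhds_zero_of_lt_one (r := (1 / 2 : ℝ)) (by norm_num)
        (by norm_num)).mono_left Nat.hyperfilter_le_atTop
      simpa using this.const_add (t - s)
    refine le_of_tendsto_of_tendsto' h1 h2 fun m => ?_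
    have hp : (0 : ℝ) < 2 ^ m := by positivity
    have h3 : (Y t - Y s : lp (fun _ : ℕ => X) ⊤) m =
        ((2 : ℝ) ^ m)⁻¹ • (x m (e m t) - x m (e m s)) := by
      rw [smul_sub]; rfl
    have hmono : e m s ≤ e m t := by
      refine min_le_min_right _ (Nat.floor_le_floor ?_)
      gcongr
    have h4 := norm_sub_le_of_forall_norm_succ_sub_le (hx1 m) hmono (he m t)
    have h5 := min_floor_sub_min_floor_le hst (2 ^ m)
    rw [h3, norm_smul, norm_inv, norm_pow, Real.norm_two, inv_mul_le_iff₀ hp, mul_add, one_div,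
      inv_pow, mul_inv_cancel₀ hp.ne']
    rw [Nat.cast_pow, Nat.cast_ofNat] at h5
    simp only [e] at h4 ⊢
    push_cast at h4 h5 ⊢
    linarith
  refine ⟨g, LipschitzWith.of_dist_le_mul fun s t => ?_, fun n k hk => ?_⟩
  · rw [NNReal.coe_one, one_mul]
    rcases le_total s t with hst | hst
    · rw [dist_comm, dist_comm s, dist_eq_norm, Real.dist_eq, abs_of_nonneg (by linarith)]
      exact hlip s t hst
    · rw [dist_eq_norm, Real.dist_eq, abs_of_nonneg (by linarith)]
      exact hlip t s hst
  · have h1 := tendsto_norm_ultrapower_mk (U := hyperfilter ℕ)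
      (Y ((2 * k) / 2 ^ (n + 1)) + Y ((2 * k + 2) / 2 ^ (n + 1)) -
        (2 : ℝ) • Y ((2 * k + 1) / 2 ^ (n + 1)))
    refine ge_of_tendsto h1 (Nat.hyperfilter_le_atTop ?_)
    filter_upwards [eventually_ge_atTop (n + 1)] with m hm
    obtain ⟨d, rfl⟩ := Nat.exists_eq_add_of_le hm
    have hp : (0 : ℝ) < 2 ^ (n + 1) := by positivity
    have hed (i : ℕ) (hi : i ≤ 2 * k + 2) : e (n + 1 + d) (i / 2 ^ (n + 1)) = i * 2 ^ d := by
      have h2 : (i : ℝ) / 2 ^ (n + 1) * (2 ^ (n + 1 + d) : ℕ) = (i * 2 ^ d : ℕ) := by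
        push_cast
        field_simp
        ring
      have h3 : i * 2 ^ d ≤ 2 ^ (n + 1 + d) := by
        rw [pow_add]
        gcongr
        rw [pow_succ]
        omega
      simp only [e]
      rw [h2, Nat.floor_natCast, min_eq_left h3]
    have e0 := hed (2 * k) (by omega)
    have e1 := hed (2 * k + 1) (by omega)
    have e2 := hed (2 * k + 2) le_rfl
    push_cast at e0 e1 e2
    have h2 := hx2 (n + 1 + d) d k (by
      rw [pow_add]; gcongr; rw [pow_succ]; omega)
    have h3 : (Y ((2 * k) / 2 ^ (n + 1)) + Y ((2 * k + 2) / 2 ^ (n + 1)) -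
        (2 : ℝ) • Y ((2 * k + 1) / 2 ^ (n + 1)) : lp (fun _ : ℕ => X) ⊤) (n + 1 + d) =
        ((2 : ℝ) ^ (n + 1 + d))⁻¹ • (x (n + 1 + d) (2 * k * 2 ^ d) +
          x (n + 1 + d) ((2 * k + 2) * 2 ^ d) - (2 : ℝ) • x (n + 1 + d) ((2 * k + 1) * 2 ^ d)) := by
      rw [← e0, ← e1, ← e2, smul_sub, smul_add, smul_comm _ (2 : ℝ)]
      rfl
    rw [h3, norm_smul, norm_inv, norm_pow, Real.norm_two, le_inv_mul_iff₀ (by positivity)]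
    refine le_trans (le_of_eq ?_) h2
    rw [pow_add, pow_succ]
    field_simp

theorem exists_not_isReflexiveBanach_of_lipschitz {Z : Type} [NormedAddCommGroup Z]
    [NormedSpace ℝ Z] [CompleteSpace Z] {g : ℝ → Z} {K : NNReal} (hg : LipschitzWith K g)
    {δ : ℝ} (hδ : 0 < δ)
    (hgδ : ∀ n k : ℕ, k < 2 ^ n → δ / 2 ^ n ≤
      ‖g ((2 * k) / 2 ^ (n + 1)) + g ((2 * k + 2) / 2 ^ (n + 1)) -
        (2 : ℝ) • g ((2 * k + 1) / 2 ^ (n + 1))‖) :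
    ∃ W : Submodule ℝ Z, CompleteSpace W ∧ ¬ IsReflexiveBanach W := by
  let W : Submodule ℝ Z := (Submodule.span ℝ (Set.range g)).topologicalClosure
  have hWc : IsClosed (W : Set Z) := Submodule.isClosed_topologicalClosure _
  have : CompleteSpace W := hWc.completeSpace_coe
  refine ⟨W, this, fun hW => ?_⟩
  have : TopologicalSpace.SeparableSpace W := by
    have h1 : TopologicalSpace.IsSeparable (Set.range g) :=
      TopologicalSpace.isSeparable_range hg.continuous
    exact (h1.span (R := ℝ)).closure.separableSpace
  let g' : ℝ → W := fun t => ⟨g t, subset_closure (Submodule.subset_span ⟨t, rfl⟩)⟩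
  have hg' : LipschitzWith K g' := hg
  have hae := hg'.ae_exists_hasDerivAt_of_reflexive hW
  obtain ⟨t, ht, w, hw⟩ : ∃ t ∈ Set.Ico (0 : ℝ) 1, ∃ w, HasDerivAt g' w t := by
    by_contra! hcon
    have h0 : MeasureTheory.volume (Set.Ico (0 : ℝ) 1) = 0 :=
      MeasureTheory.measure_mono_null (fun t ht => by simpa using hcon t ht)
        (MeasureTheory.ae_iff.1 hae)
    simp at h0
  exact not_hasDerivAt_of_dyadic_second_difference (g := g') hδ hgδ ht.1 ht.2 w hw

theorem not_superReflexive_of_lipschitz_ultrapower [CompleteSpace X] {U : Ultrafilter ℕ}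
    {g : ℝ → Ultrapower X U} {K : NNReal} (hg : LipschitzWith K g) {δ : ℝ} (hδ : 0 < δ)
    (hgδ : ∀ n k : ℕ, k < 2 ^ n → δ / 2 ^ n ≤
      ‖g ((2 * k) / 2 ^ (n + 1)) + g ((2 * k + 2) / 2 ^ (n + 1)) -
        (2 : ℝ) • g ((2 * k + 1) / 2 ^ (n + 1))‖) :
    ¬ SuperReflexive X := by
  intro hX
  obtain ⟨W, _, hW⟩ := exists_not_isReflexiveBanach_of_lipschitz hg hδ hgδ
  exact hW (hX W (finitelyRepresentable_of_linearIsometry_ultrapower W.subtypeₗᵢ))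

end Differentiation

/-- A space containing binary trees with uniformly bounded distortion is not superreflexive. -/
theorem not_superReflexive_of_tree_embeddings {X : Type} [NormedAddCommGroup X] [NormedSpace ℝ X]
    [CompleteSpace X] {C : ℝ} (hC : 1 ≤ C)
    (h : ∀ n : ℕ, ∃ r : ℝ, 0 < r ∧ ∃ f : BinTree n → X, ∀ u v : BinTree n,
      r * treeDist u.1 v.1 ≤ ‖f u - f v‖ ∧ ‖f u - f v‖ ≤ r * C * treeDist u.1 v.1) :
    ¬ SuperReflexive X := by
  have hC0 : 0 < C := by linarith
  obtain ⟨g, hg, hgδ⟩ := exists_lipschitz_ultrapower (X := X) (c := C⁻¹) fun m => by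
    obtain ⟨r, hr, f, hf⟩ := h (2 ^ m)
    let F : List Bool → X := fun l =>
      if hl : l.length ≤ 2 ^ m then (r * C)⁻¹ • f ⟨l, hl⟩ else 0
    refine exists_path_second_difference (F := F) fun u v hu hv => ?_
    obtain ⟨h1, h2⟩ := hf ⟨u, hu⟩ ⟨v, hv⟩
    simp only [F, hu, hv, dif_pos]
    rw [← smul_sub, norm_smul, norm_inv, Real.norm_of_nonneg (by positivity : 0 ≤ r * C)]
    constructor
    · rw [le_inv_mul_iff₀ (by positivity)]
      refine le_trans (le_of_eq ?_) h1
      field_simp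
    · rw [inv_mul_le_iff₀ (by positivity)]
      exact h2
  exact not_superReflexive_of_lipschitz_ultrapower hg (by positivity) hgδ

/-- Bourgain's characterization of superreflexivity in terms of binary trees. -/
theorem bourgain_tree_characterization
    (X : Type) [NormedAddCommGroup X] [NormedSpace ℝ X] [CompleteSpace X] :
    ¬ SuperReflexive X ↔
      ∃ C : ℝ, 1 ≤ C ∧ ∀ n : ℕ, ∃ r : ℝ, 0 < r ∧ ∃ f : BinTree n → X,
        ∀ u v : BinTree n,
          r * treeDist u.1 v.1 ≤ ‖f u - f v‖ ∧ ‖f u - f v‖ ≤ r * C * treeDist u.1 v.1 := by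
  exact ⟨exists_tree_embeddings_of_not_superReflexive,
    fun ⟨_, hC, h⟩ => not_superReflexive_of_tree_embeddings hC h⟩
end
end

section
/- Let X be a Banach space whose norm satisfies δ_X(ε) ≥ c·ε^q for some c > 0 and q ∈ [2,∞), where δ_X is the modulus of convexity. Then there exists a constant K > 0 (depending only on c and q) with the following property: for every D ≥ 1 and all vectors x₀, x₁, x₂, x₂′ in X satisfying 1 ≤ ‖x₁ − x₀‖ ≤ D, 1 ≤ ‖x₂ − x₁‖ ≤ D, 1 ≤ ‖x₂′ − x₁‖ ≤ D, 2 ≤ ‖x₂ − x₀‖ ≤ 2D, 2 ≤ ‖x₂′ − x₀‖ ≤ 2D, and 2 ≤ ‖x₂ − x₂′‖ ≤ 2D (i.e., the map sending the fork a₀,a₁,a₂,a₂′ to x₀,x₁,x₂,x₂′ is D-Lipschitz and distance non-decreasing), one has either ‖x₂ − x₀‖ ≤ 2(D − K/D^{q−1}) or ‖x₂′ − x₀‖ ≤ 2(D − K/D^{q−1}). -/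
noncomputable section

/-- Replacing a nonzero vector of norm at most `D` by its radial projection on the sphere of
radius `D` moves it by `D - ‖v‖`. -/
theorem norm_smul_normalize_sub {X : Type*} [NormedAddCommGroup X] [NormedSpace ℝ X]
    {D : ℝ} {v : X} (hv : 0 < ‖v‖) (hvD : ‖v‖ ≤ D) :
    ‖D • (‖v‖⁻¹ • v) - v‖ = D - ‖v‖ := by
  have h : D • (‖v‖⁻¹ • v) - v = (D * ‖v‖⁻¹ - 1) • v := by
    rw [sub_smul, one_smul, smul_smul]
  have h1 : 0 ≤ D * ‖v‖⁻¹ - 1 := by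
    rw [sub_nonneg, ← div_eq_mul_inv, one_le_div hv]
    exact hvD
  rw [h, norm_smul, Real.norm_of_nonneg h1]
  field_simp

/-- In a space with modulus of convexity at least `c ε^q`, two vectors of norm at most `D` whose
sum has norm close to `2 * D` have close directions. -/
theorem norm_normalize_sub_lt {X : Type*} [NormedAddCommGroup X] [NormedSpace ℝ X]
    {c q : ℝ}
    (hX : ∀ x y : X, ‖x‖ = 1 → ‖y‖ = 1 → ∀ ε : ℝ, 0 < ε → ε ≤ 2 → ε ≤ ‖x - y‖ →
      ‖(2⁻¹ : ℝ) • (x + y)‖ ≤ 1 - c * ε ^ q)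
    {D η ε : ℝ} {u v : X} (hu : 0 < ‖u‖) (huD : ‖u‖ ≤ D) (hv : 0 < ‖v‖) (hvD : ‖v‖ ≤ D)
    (hε : 0 < ε) (hε2 : ε ≤ 2) (hη : 2 * η ≤ D * (c * ε ^ q))
    (huv : 2 * (D - η) < ‖u + v‖) :
    ‖‖u‖⁻¹ • u - ‖v‖⁻¹ • v‖ < ε := by
  by_contra! hcon
  have hD : 0 < D := hu.trans_le huD
  have hmid := hX _ _ (by rw [norm_smul, norm_inv, norm_norm, inv_mul_cancel₀ hu.ne'])
    (by rw [norm_smul, norm_inv, norm_norm, inv_mul_cancel₀ hv.ne']) ε hε hε2 hcon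
  rw [norm_smul, Real.norm_of_nonneg (by norm_num)] at hmid
  have hscale : ‖D • (‖u‖⁻¹ • u + ‖v‖⁻¹ • v)‖ = D * ‖‖u‖⁻¹ • u + ‖v‖⁻¹ • v‖ := by
    rw [norm_smul, Real.norm_of_nonneg hD.le]
  have hsplit : u + v = D • (‖u‖⁻¹ • u + ‖v‖⁻¹ • v) -
      ((D • (‖u‖⁻¹ • u) - u) + (D • (‖v‖⁻¹ • v) - v)) := by
    rw [smul_add]; abel
  have h1 := norm_sub_le (D • (‖u‖⁻¹ • u + ‖v‖⁻¹ • v))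
    ((D • (‖u‖⁻¹ • u) - u) + (D • (‖v‖⁻¹ • v) - v))
  have h2 := norm_add_le (D • (‖u‖⁻¹ • u) - u) (D • (‖v‖⁻¹ • v) - v)
  rw [← hsplit, hscale] at h1
  rw [norm_smul_normalize_sub hu huD, norm_smul_normalize_sub hv hvD] at h2
  have h3 := norm_add_le u v
  have h4 := mul_le_mul_of_nonneg_left hmid hD.le
  linarith

/-- Kloeckner's fork lemma: in a Banach space whose modulus of convexity satisfies
`δ_X(ε) ≥ c ε^q`, for every `D`-Lipschitz distance non-decreasing image `x₀,x₁,x₂,x₂′`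
of the fork, one of the two prongs is mapped at distance at most `2(D − K/D^{q−1})`
from the root. -/
theorem fork_lemma (c q : ℝ) (hc : 0 < c) (hq : 2 ≤ q) :
    ∃ K : ℝ, 0 < K ∧
      ∀ (X : Type) [NormedAddCommGroup X] [NormedSpace ℝ X] [CompleteSpace X],
        -- the modulus of convexity of `X` satisfies `δ_X(ε) ≥ c ε^q`:
        (∀ x y : X, ‖x‖ = 1 → ‖y‖ = 1 → ∀ ε : ℝ, 0 < ε → ε ≤ 2 → ε ≤ ‖x - y‖ →
            ‖(2⁻¹ : ℝ) • (x + y)‖ ≤ 1 - c * ε ^ q) →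
        ∀ D : ℝ, 1 ≤ D → ∀ x₀ x₁ x₂ x₂' : X,
          1 ≤ ‖x₁ - x₀‖ → ‖x₁ - x₀‖ ≤ D →
          1 ≤ ‖x₂ - x₁‖ → ‖x₂ - x₁‖ ≤ D →
          1 ≤ ‖x₂' - x₁‖ → ‖x₂' - x₁‖ ≤ D →
          2 ≤ ‖x₂ - x₀‖ → ‖x₂ - x₀‖ ≤ 2 * D →
          2 ≤ ‖x₂' - x₀‖ → ‖x₂' - x₀‖ ≤ 2 * D →
          2 ≤ ‖x₂ - x₂'‖ → ‖x₂ - x₂'‖ ≤ 2 * D →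
          ‖x₂ - x₀‖ ≤ 2 * (D - K / D ^ (q - 1)) ∨
            ‖x₂' - x₀‖ ≤ 2 * (D - K / D ^ (q - 1)) := by
  refine ⟨min (1 / 4) (c * (1 / 2) ^ q / 2), by positivity, ?_⟩
  intro X _ _ _ hX D hD x₀ x₁ x₂ x₂' hu huD hv hvD hv' hvD' _ _ _ _ hvv _
  set K : ℝ := min (1 / 4) (c * (1 / 2) ^ q / 2)
  have hD0 : 0 < D := by linarith
  have hK0 : 0 < K := by positivity
  have hηK : K / D ^ (q - 1) ≤ 1 / 4 :=
    (div_le_self hK0.le (Real.one_le_rpow hD (by linarith))).trans (min_le_left _ _)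
  have hη : 2 * (K / D ^ (q - 1)) ≤ D * (c * (1 / 2 / D) ^ q) := by
    have hKc : K ≤ c * (1 / 2) ^ q / 2 := min_le_right _ _
    have hDq : 0 < D ^ q := Real.rpow_pos_of_pos hD0 q
    rw [Real.div_rpow (by norm_num) hD0.le, Real.rpow_sub_one hD0.ne']
    calc 2 * (K / (D ^ q / D)) = D * (2 * K / D ^ q) := by field_simp
      _ ≤ D * (c * (1 / 2) ^ q / D ^ q) := by
          have h2K : 2 * K ≤ c * (1 / 2) ^ q := by linarith
          gcongr
      _ = D * (c * ((1 / 2) ^ q / D ^ q)) := by ring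
  set η := K / D ^ (q - 1)
  by_contra! hfar
  obtain ⟨hfar, hfar'⟩ := hfar
  have hε : 0 < 1 / 2 / D := by positivity
  have hε2 : 1 / 2 / D ≤ 2 := by rw [div_le_iff₀ hD0]; linarith
  have hsum : x₁ - x₀ + (x₂ - x₁) = x₂ - x₀ := by abel
  have hsum' : x₁ - x₀ + (x₂' - x₁) = x₂' - x₀ := by abel
  have hdiff : x₂ - x₁ - (x₂' - x₁) = x₂ - x₂' := by abel
  rw [← hsum] at hfar
  rw [← hsum'] at hfar'
  rw [← hdiff] at hvv
  generalize x₁ - x₀ = u at *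
  generalize x₂ - x₁ = v at *
  generalize x₂' - x₁ = v' at *
  have hu0 : 0 < ‖u‖ := by linarith
  have hv0 : 0 < ‖v‖ := by linarith
  have hv0' : 0 < ‖v'‖ := by linarith
  have hclose := norm_normalize_sub_lt hX hu0 huD hv0 hvD hε hε2 hη hfar
  have hclose' := norm_normalize_sub_lt hX hu0 huD hv0' hvD' hε hε2 hη hfar'
  have hdir := norm_sub_le_norm_sub_add_norm_sub (‖v‖⁻¹ • v) (‖u‖⁻¹ • u) (‖v'‖⁻¹ • v')
  rw [norm_sub_rev (‖v‖⁻¹ • v) (‖u‖⁻¹ • u)] at hdir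
  have hprod : D * ‖‖v‖⁻¹ • v - ‖v'‖⁻¹ • v'‖ < 1 := by
    calc D * ‖‖v‖⁻¹ • v - ‖v'‖⁻¹ • v'‖ < D * (1 / 2 / D + 1 / 2 / D) := by
          gcongr; linarith
      _ = 1 := by field_simp; norm_num
  have hscale : ‖D • (‖v‖⁻¹ • v - ‖v'‖⁻¹ • v')‖ = D * ‖‖v‖⁻¹ • v - ‖v'‖⁻¹ • v'‖ := by
    rw [norm_smul, Real.norm_of_nonneg hD0.le]
  have hsplit : v - v' = D • (‖v‖⁻¹ • v - ‖v'‖⁻¹ • v') -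
      ((D • (‖v‖⁻¹ • v) - v) - (D • (‖v'‖⁻¹ • v') - v')) := by
    rw [smul_sub]; abel
  have h1 := norm_sub_le (D • (‖v‖⁻¹ • v - ‖v'‖⁻¹ • v'))
    ((D • (‖v‖⁻¹ • v) - v) - (D • (‖v'‖⁻¹ • v') - v'))
  have h2 := norm_sub_le (D • (‖v‖⁻¹ • v) - v) (D • (‖v'‖⁻¹ • v') - v')
  rw [← hsplit, hscale] at h1
  rw [norm_smul_normalize_sub hv0 hvD, norm_smul_normalize_sub hv0' hvD'] at h2
  have h3 := norm_add_le u v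
  have h4 := norm_add_le u v'
  linarith
end
end
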